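/- arXiv:2101.12636 — 2 statements merged into one kernel-verified Lean document; each statement's English description precedes it below -/
import Mathlib

section
/- Let m ≥ 1, N > 2m, n ≥ 2, and let e_{ij} = 1 if i ≠ j and e_{ij} = 0 if i = j. Let p_{ij}, q_{ij} ≥ 1 for all i ≠ j, let each Ψ_{ij} satisfy condition (K), and assume that for every pair k ≠ ℓ one has limsup_{r→∞} min{ r^{2N−(N−2m)(p_{kℓ}+q_{kℓ})} Ψ_{kℓ}(r), r^{2N−(N−2m)(p_{ℓk}+q_{ℓk})} Ψ_{ℓk}(r) } > 0. Then every non-negative solution of the system (−Δ)^m u_i ≥ Σ_{j=1}^n e_{ij} (Ψ_{ij}(|·|) * u_j^{p_{ij}}) u_i^{q_{ij}} in ℝ^N, 1 ≤ i ≤ n, has at most one non-zero component: there exists j ∈ {1,…,n} such that u_i ≡ 0 for all i ≠ j. -/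
open MeasureTheory Filter Metric

/-- The Laplacian of `u : ℝ^N → ℝ`, defined via the second iterated Fréchet derivative. -/
noncomputable def lap {N : ℕ} (u : EuclideanSpace ℝ (Fin N) → ℝ) :
    EuclideanSpace ℝ (Fin N) → ℝ :=
  fun x => ∑ i : Fin N,
    iteratedFDeriv ℝ 2 u x ![EuclideanSpace.single i 1, EuclideanSpace.single i 1]

/-- `negLapPow m u = (-Δ)^m u`, the `m`-fold iterate of the negative Laplacian. -/
noncomputable def negLapPow {N : ℕ} (m : ℕ) (u : EuclideanSpace ℝ (Fin N) → ℝ) :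
    EuclideanSpace ℝ (Fin N) → ℝ :=
  (fun v => fun x => -(lap v x))^[m] u

/-- Condition (K) on the kernel `Ψ`. -/
structure CondK (N : ℕ) (Ψ : ℝ → ℝ) : Prop where
  pos : ∀ r : ℝ, 0 < r → 0 < Ψ r
  cont : ContinuousOn (fun x : EuclideanSpace ℝ (Fin N) => Ψ ‖x‖)
    {(0 : EuclideanSpace ℝ (Fin N))}ᶜ
  locInt : LocallyIntegrable (fun x : EuclideanSpace ℝ (Fin N) => Ψ ‖x‖) volume
  anti : AntitoneOn Ψ (Set.Ioi (0 : ℝ))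
  tendsto : Tendsto (fun r : ℝ => r ^ N * Ψ r) atTop atTop

section Laplacian

variable {N : ℕ}

lemma lap_eq_sum_fderiv_fderiv (u : EuclideanSpace ℝ (Fin N) → ℝ) (x : EuclideanSpace ℝ (Fin N)) :
    lap u x = ∑ i, fderiv ℝ (fderiv ℝ u) x (EuclideanSpace.single i 1)
      (EuclideanSpace.single i 1) := by
  simp [lap, iteratedFDeriv_two_apply]

lemma lap_eq_sum_of_contDiffAt {u : EuclideanSpace ℝ (Fin N) → ℝ} {x : EuclideanSpace ℝ (Fin N)}
    (hu : ContDiffAt ℝ 2 u x) :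
    lap u x = ∑ i, fderiv ℝ (fun y => fderiv ℝ u y (EuclideanSpace.single i 1)) x
      (EuclideanSpace.single i 1) := by
  have hd : DifferentiableAt ℝ (fderiv ℝ u) x :=
    (hu.fderiv_right (m := 1) (by norm_num)).differentiableAt (by norm_num)
  rw [lap_eq_sum_fderiv_fderiv]
  refine Finset.sum_congr rfl fun i _ => ?_
  rw [fderiv_clm_apply hd (differentiableAt_const _)]
  simp

lemma lap_congr {f g : EuclideanSpace ℝ (Fin N) → ℝ} {x : EuclideanSpace ℝ (Fin N)}
    (h : f =ᶠ[nhds x] g) : lap f =ᶠ[nhds x] lap g := by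
  filter_upwards [h.iteratedFDeriv ℝ 2] with y hy
  simp only [lap, hy]

lemma negLapPow_succ (m : ℕ) (u : EuclideanSpace ℝ (Fin N) → ℝ) :
    negLapPow (m + 1) u = fun x => -lap (negLapPow m u) x := by
  unfold negLapPow
  rw [Function.iterate_succ_apply']

lemma negLapPow_succ' (m : ℕ) (u : EuclideanSpace ℝ (Fin N) → ℝ) :
    negLapPow (m + 1) u = negLapPow m (fun x => -lap u x) := rfl

lemma negLapPow_congr (m : ℕ) {f g : EuclideanSpace ℝ (Fin N) → ℝ} {x : EuclideanSpace ℝ (Fin N)}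
    (h : f =ᶠ[nhds x] g) : negLapPow m f =ᶠ[nhds x] negLapPow m g := by
  induction m with
  | zero => exact h
  | succ m ih =>
    rw [negLapPow_succ, negLapPow_succ]
    exact (lap_congr ih).neg

lemma lap_const_mul_comp_smul (a c : ℝ) (f : EuclideanSpace ℝ (Fin N) → ℝ) :
    lap (fun x => a * f (c • x)) = fun x => a * c ^ 2 * lap f (c • x) := by
  have h1 : fderiv ℝ (fun x => a * f (c • x)) = fun x => (a * c) • fderiv ℝ f (c • x) := by
    funext x
    have := fderiv_comp_smul (f := f) (x := x) c
    change fderiv ℝ (a • fun x => f (c • x)) x = _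
    rw [fderiv_const_smul_field, Pi.smul_apply, this, smul_smul]
  funext x
  have h2 : fderiv ℝ (fun x => (a * c) • fderiv ℝ f (c • x)) x
      = (a * c * c) • fderiv ℝ (fderiv ℝ f) (c • x) := by
    have := fderiv_comp_smul (f := fderiv ℝ f) (x := x) c
    refine (congrFun (fderiv_const_smul_field (𝕜 := ℝ) (f := fun x => fderiv ℝ f (c • x))
      (a * c)) x).trans ?_
    rw [Pi.smul_apply, this, smul_smul]
  rw [lap_eq_sum_fderiv_fderiv, lap_eq_sum_fderiv_fderiv, h1, h2, Finset.mul_sum]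
  refine Finset.sum_congr rfl fun i _ => ?_
  simp only [smul_apply, smul_eq_mul]
  ring

lemma lap_const_mul (a : ℝ) (f : EuclideanSpace ℝ (Fin N) → ℝ) :
    lap (fun x => a * f x) = fun x => a * lap f x := by
  simpa using lap_const_mul_comp_smul a 1 f

lemma negLapPow_const_mul_comp_smul (m : ℕ) (a c : ℝ) (f : EuclideanSpace ℝ (Fin N) → ℝ) :
    negLapPow m (fun x => a * f (c • x)) = fun x => a * c ^ (2 * m) * negLapPow m f (c • x) := by
  induction m with
  | zero => simp [negLapPow]
  | succ m ih =>
    rw [negLapPow_succ, negLapPow_succ, ih, lap_const_mul_comp_smul]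
    funext x
    ring

lemma lap_const (a : ℝ) : lap (fun _ : EuclideanSpace ℝ (Fin N) => a) = fun _ => 0 := by
  funext x
  simp [lap_eq_sum_fderiv_fderiv]

lemma negLapPow_const {m : ℕ} (hm : 1 ≤ m) (a : ℝ) :
    negLapPow m (fun _ : EuclideanSpace ℝ (Fin N) => a) = fun _ => 0 := by
  induction m, hm using Nat.le_induction with
  | base => simp [negLapPow, lap_const]
  | succ m _ ih => simp [negLapPow_succ, ih, lap_const]

lemma contDiff_lap {k : WithTop ℕ∞} {u : EuclideanSpace ℝ (Fin N) → ℝ}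
    (hu : ContDiff ℝ (k + 2) u) : ContDiff ℝ k (lap u) := by
  have h2 : lap u = fun x => ∑ i, fderiv ℝ (fderiv ℝ u) x (EuclideanSpace.single i 1)
      (EuclideanSpace.single i 1) := funext (lap_eq_sum_fderiv_fderiv u)
  have h1 : ContDiff ℝ (k + 1) (fderiv ℝ u) :=
    hu.fderiv_right (by rw [add_assoc]; norm_num)
  have h3 : ContDiff ℝ k (fderiv ℝ (fderiv ℝ u)) := h1.fderiv_right le_rfl
  rw [h2]
  exact ContDiff.sum fun i _ => (h3.clm_apply contDiff_const).clm_apply contDiff_const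

lemma continuous_negLapPow (m : ℕ) {u : EuclideanSpace ℝ (Fin N) → ℝ}
    (hu : ContDiff ℝ (2 * m) u) : Continuous (negLapPow m u) := by
  induction m generalizing u with
  | zero => exact hu.continuous
  | succ m ih =>
    rw [negLapPow_succ']
    refine ih (contDiff_lap (k := 2 * m) ?_).neg
    convert hu using 1
    push_cast; ring

lemma contDiff_negLapPow (m : ℕ) {u : EuclideanSpace ℝ (Fin N) → ℝ}
    (hu : ContDiff ℝ (⊤ : ℕ∞) u) : ContDiff ℝ (⊤ : ℕ∞) (negLapPow m u) := by
  induction m with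
  | zero => exact hu
  | succ m ih =>
    rw [negLapPow_succ]
    have htop : ((⊤ : ℕ∞) : WithTop ℕ∞) + 2 = (⊤ : ℕ∞) := rfl
    exact (contDiff_lap (k := (⊤ : ℕ∞)) (htop ▸ ih)).neg

lemma HasCompactSupport.lap {u : EuclideanSpace ℝ (Fin N) → ℝ}
    (hu : HasCompactSupport u) : HasCompactSupport (lap u) := by
  refine hu.mono' fun x hx => ?_
  by_contra hcon
  have h0 : u =ᶠ[nhds x] fun _ => 0 := notMem_tsupport_iff_eventuallyEq.mp hcon
  exact hx (by rw [(lap_congr h0).eq_of_nhds, lap_const])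

lemma HasCompactSupport.negLapPow (m : ℕ) {u : EuclideanSpace ℝ (Fin N) → ℝ}
    (hu : HasCompactSupport u) : HasCompactSupport (negLapPow m u) := by
  induction m with
  | zero => exact hu
  | succ m ih =>
    rw [negLapPow_succ]
    exact ih.lap.comp_left (g := fun t : ℝ => -t) neg_zero

lemma integral_lap_mul {u φ : EuclideanSpace ℝ (Fin N) → ℝ} (hu : ContDiff ℝ 2 u)
    (hφ : ContDiff ℝ 2 φ) (hc : HasCompactSupport φ) :
    ∫ x, lap u x * φ x = ∫ x, u x * lap φ x := by
  have hu1 : ContDiff ℝ 1 (fderiv ℝ u) := hu.fderiv_right (by norm_num)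
  have hφ1 : ContDiff ℝ 1 (fderiv ℝ φ) := hφ.fderiv_right (by norm_num)
  have key : ∀ v : EuclideanSpace ℝ (Fin N),
      Integrable (fun x => fderiv ℝ (fun y => fderiv ℝ u y v) x v * φ x) ∧
      Integrable (fun x => u x * fderiv ℝ (fun y => fderiv ℝ φ y v) x v) ∧
      ∫ x, fderiv ℝ (fun y => fderiv ℝ u y v) x v * φ x
        = ∫ x, u x * fderiv ℝ (fun y => fderiv ℝ φ y v) x v := by
    intro v
    have hdu : ContDiff ℝ 1 (fun y => fderiv ℝ u y v) := hu1.clm_apply contDiff_const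
    have hdφ : ContDiff ℝ 1 (fun y => fderiv ℝ φ y v) := hφ1.clm_apply contDiff_const
    have cddu : Continuous fun x => fderiv ℝ (fun y => fderiv ℝ u y v) x v :=
      (hdu.continuous_fderiv (by norm_num)).clm_apply continuous_const
    have cddφ : Continuous fun x => fderiv ℝ (fun y => fderiv ℝ φ y v) x v :=
      (hdφ.continuous_fderiv (by norm_num)).clm_apply continuous_const
    have sφ : HasCompactSupport fun y => fderiv ℝ φ y v := hc.fderiv_apply ℝ v
    have sφ2 : HasCompactSupport fun x => fderiv ℝ (fun y => fderiv ℝ φ y v) x v :=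
      sφ.fderiv_apply ℝ v
    have i1 : Integrable (fun x => fderiv ℝ (fun y => fderiv ℝ u y v) x v * φ x) :=
      (cddu.mul hφ.continuous).integrable_of_hasCompactSupport hc.mul_left
    have i2 : Integrable (fun x => u x * fderiv ℝ (fun y => fderiv ℝ φ y v) x v) :=
      (hu.continuous.mul cddφ).integrable_of_hasCompactSupport sφ2.mul_left
    have i3 : Integrable (fun x => fderiv ℝ u x v * fderiv ℝ φ x v) :=
      (hdu.continuous.mul hdφ.continuous).integrable_of_hasCompactSupport sφ.mul_left
    have i4 : Integrable (fun x => fderiv ℝ u x v * φ x) :=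
      (hdu.continuous.mul hφ.continuous).integrable_of_hasCompactSupport hc.mul_left
    have i5 : Integrable (fun x => u x * fderiv ℝ φ x v) :=
      (hu.continuous.mul hdφ.continuous).integrable_of_hasCompactSupport sφ.mul_left
    refine ⟨i1, i2, ?_⟩
    have e1 := integral_mul_fderiv_eq_neg_fderiv_mul_of_integrable
      (f := fun y => fderiv ℝ u y v) (g := φ) (v := v) i1 i3 i4
      (fun x _ => (hdu.differentiable (by norm_num)).differentiableAt)
      (fun x _ => (hφ.differentiable (by norm_num)).differentiableAt)
    have e2 := integral_mul_fderiv_eq_neg_fderiv_mul_of_integrable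
      (f := u) (g := fun y => fderiv ℝ φ y v) (v := v) i3 i2 i5
      (fun x _ => (hu.differentiable (by norm_num)).differentiableAt)
      (fun x _ => (hdφ.differentiable (by norm_num)).differentiableAt)
    linarith
  simp_rw [lap_eq_sum_of_contDiffAt hu.contDiffAt, lap_eq_sum_of_contDiffAt hφ.contDiffAt,
    Finset.sum_mul, Finset.mul_sum]
  rw [integral_finsetSum _ fun i _ => (key _).1, integral_finsetSum _ fun i _ => (key _).2.1]
  exact Finset.sum_congr rfl fun i _ => (key _).2.2

lemma integral_negLapPow_mul (m : ℕ) {u φ : EuclideanSpace ℝ (Fin N) → ℝ}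
    (hu : ContDiff ℝ (2 * m) u) (hφ : ContDiff ℝ (⊤ : ℕ∞) φ) (hc : HasCompactSupport φ) :
    ∫ x, negLapPow m u x * φ x = ∫ x, u x * negLapPow m φ x := by
  induction m generalizing u with
  | zero => rfl
  | succ m ih =>
    have hu' : ContDiff ℝ (2 * m + 2) u := by
      convert hu using 1
      push_cast; ring
    have hlt : (2 : WithTop ℕ∞) ≤ 2 * m + 2 := by
      exact_mod_cast Nat.le_add_left 2 (2 * m)
    rw [negLapPow_succ', ih (contDiff_lap hu').neg, negLapPow_succ]
    simp only [neg_mul, mul_neg, integral_neg]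
    rw [integral_lap_mul (hu'.of_le hlt)
      ((contDiff_negLapPow m hφ).of_le (WithTop.coe_le_coe.2 (le_top : (2 : ℕ∞) ≤ ⊤))) (hc.negLapPow m)]

lemma lap_norm_sq_rpow (a : ℝ) {x : EuclideanSpace ℝ (Fin N)} (hx : x ≠ 0) :
    lap (fun y => (‖y‖ ^ 2) ^ a) x = 2 * a * (2 * a - 2 + N) * (‖x‖ ^ 2) ^ (a - 1) := by
  have hsq : ∀ y : EuclideanSpace ℝ (Fin N), y ≠ 0 → 0 < ‖y‖ ^ 2 := fun y hy => by positivity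
  have hder : ∀ (b : ℝ) (y : EuclideanSpace ℝ (Fin N)), y ≠ 0 →
      HasFDerivAt (fun y : EuclideanSpace ℝ (Fin N) => (‖y‖ ^ 2) ^ b)
        ((b * (‖y‖ ^ 2) ^ (b - 1)) • (2 • innerSL ℝ y)) y := by
    intro b y hy
    exact (hasStrictFDerivAt_norm_sq y).hasFDerivAt.rpow_const (Or.inl (hsq y hy).ne')
  have hcd : ContDiffAt ℝ 2 (fun y : EuclideanSpace ℝ (Fin N) => (‖y‖ ^ 2) ^ a) x :=
    (contDiff_norm_sq ℝ).contDiffAt.rpow_const_of_ne (hsq x hx).ne'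
  rw [lap_eq_sum_of_contDiffAt hcd]
  have hnear : ∀ᶠ y in nhds x, y ≠ 0 := isOpen_ne.mem_nhds hx
  have hterm : ∀ i : Fin N,
      fderiv ℝ (fun y => fderiv ℝ (fun y : EuclideanSpace ℝ (Fin N) => (‖y‖ ^ 2) ^ a) y
        (EuclideanSpace.single i 1)) x (EuclideanSpace.single i 1)
      = 4 * a * (a - 1) * (‖x‖ ^ 2) ^ (a - 2) * x i ^ 2 + 2 * a * (‖x‖ ^ 2) ^ (a - 1) := by
    intro i
    have h1 : (fun y => fderiv ℝ (fun y : EuclideanSpace ℝ (Fin N) => (‖y‖ ^ 2) ^ a) y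
        (EuclideanSpace.single i 1)) =ᶠ[nhds x]
        fun y => (2 * a) * ((‖y‖ ^ 2) ^ (a - 1) * (EuclideanSpace.proj i : EuclideanSpace ℝ (Fin N) →L[ℝ] ℝ) y) := by
      filter_upwards [hnear] with y hy
      rw [(hder a y hy).fderiv]
      simp [EuclideanSpace.inner_single_right]
      ring
    rw [h1.fderiv_eq]
    have h2 : HasFDerivAt (fun y : EuclideanSpace ℝ (Fin N) => (2 * a) * ((‖y‖ ^ 2) ^ (a - 1) *
        (EuclideanSpace.proj i : EuclideanSpace ℝ (Fin N) →L[ℝ] ℝ) y)) _ x := ((hder (a - 1) x hx).mul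
      (EuclideanSpace.proj i : EuclideanSpace ℝ (Fin N) →L[ℝ] ℝ).hasFDerivAt).const_mul (2 * a)
    rw [h2.fderiv]
    simp [EuclideanSpace.inner_single_right]
    rw [show a - 1 - 1 = a - 2 by ring]
    ring
  simp_rw [hterm]
  rw [Finset.sum_add_distrib, ← Finset.mul_sum]
  have hs : ∑ i, x i ^ 2 = ‖x‖ ^ 2 := (EuclideanSpace.real_norm_sq_eq x).symm
  have hp : (‖x‖ ^ 2) ^ (a - 1) = (‖x‖ ^ 2) ^ (a - 2) * ‖x‖ ^ 2 := by
    rw [← Real.rpow_add_one (hsq x hx).ne']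
    congr 1; ring
  rw [hs, hp]
  simp
  ring

lemma negLapPow_norm_sq_rpow_eq_zero {m : ℕ} (hm : 1 ≤ m) {x : EuclideanSpace ℝ (Fin N)}
    (hx : x ≠ 0) : negLapPow m (fun y => (‖y‖ ^ 2) ^ ((m : ℝ) - N / 2)) x = 0 := by
  have main : ∀ (b : ℝ) (j : ℕ), ∃ K : ℝ, ∀ y : EuclideanSpace ℝ (Fin N), y ≠ 0 →
      negLapPow j (fun y => (‖y‖ ^ 2) ^ b) y = K * (‖y‖ ^ 2) ^ (b - j) := by
    intro b j
    induction j with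
    | zero => exact ⟨1, fun y _ => by simp [negLapPow]⟩
    | succ j ih =>
      obtain ⟨K, hK⟩ := ih
      refine ⟨-(K * (2 * (b - j) * (2 * (b - j) - 2 + N))), fun y hy => ?_⟩
      have hnear : negLapPow j (fun y : EuclideanSpace ℝ (Fin N) => (‖y‖ ^ 2) ^ b) =ᶠ[nhds y]
          fun z => K * (‖z‖ ^ 2) ^ (b - j) := by
        filter_upwards [isOpen_ne.mem_nhds hy] with z hz
        rw [hK z hz]
      rw [negLapPow_succ]
      beta_reduce
      rw [(lap_congr hnear).eq_of_nhds, lap_const_mul]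
      beta_reduce
      rw [lap_norm_sq_rpow _ hy]
      push_cast
      rw [sub_add_eq_sub_sub]
      ring
  obtain ⟨j, rfl⟩ : ∃ j, m = j + 1 := ⟨m - 1, by omega⟩
  obtain ⟨K, hK⟩ := main (((j + 1 : ℕ) : ℝ) - N / 2) j
  have hnear : negLapPow j (fun y : EuclideanSpace ℝ (Fin N) =>
      (‖y‖ ^ 2) ^ (((j + 1 : ℕ) : ℝ) - N / 2)) =ᶠ[nhds x]
      fun z => K * (‖z‖ ^ 2) ^ (((j + 1 : ℕ) : ℝ) - N / 2 - j) := by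
    filter_upwards [isOpen_ne.mem_nhds hx] with z hz
    rw [hK z hz]
  rw [negLapPow_succ]
  beta_reduce
  rw [(lap_congr hnear).eq_of_nhds, lap_const_mul]
  beta_reduce
  rw [lap_norm_sq_rpow _ hx]
  push_cast
  ring

end Laplacian

section TestFunction

variable {N : ℕ}

/-- The closed annulus `{x | R ≤ ‖x‖ ≤ 2R}`. -/
def annulus (N : ℕ) (R : ℝ) : Set (EuclideanSpace ℝ (Fin N)) := {x | R ≤ ‖x‖ ∧ ‖x‖ ≤ 2 * R}

lemma exists_bound_negLapPow (m : ℕ) {f : EuclideanSpace ℝ (Fin N) → ℝ}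
    (hf : ContDiff ℝ (⊤ : ℕ∞) f) :
    ∃ C : ℝ, 0 < C ∧ ∀ y ∈ closedBall (0 : EuclideanSpace ℝ (Fin N)) 2, negLapPow m f y ≤ C := by
  obtain ⟨C, hC⟩ := (isCompact_closedBall (0 : EuclideanSpace ℝ (Fin N)) 2).exists_bound_of_continuousOn
    (contDiff_negLapPow m hf).continuous.continuousOn
  exact ⟨max C 1, by positivity, fun y hy =>
    (le_abs_self _).trans ((hC y hy).trans (le_max_left _ _))⟩

/-- A smooth positive function equal to `1` near the origin and to `‖y‖ ^ (2m - N)` outside the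
ball of radius `2`. -/
lemma exists_smoothed_fundamental_solution {m : ℕ} (hm : 1 ≤ m) (hN : 2 * m < N) :
    ∃ ζ : EuclideanSpace ℝ (Fin N) → ℝ, ContDiff ℝ (⊤ : ℕ∞) ζ ∧ (∀ y, 0 ≤ ζ y) ∧
      (∀ y, 2 < ‖y‖ → ζ y = (‖y‖ ^ 2) ^ ((m : ℝ) - N / 2)) ∧
      (∃ c : ℝ, 0 < c ∧ ∀ y, ‖y‖ ≤ 2 → c ≤ ζ y) ∧
      (∀ y, ‖y‖ < 1 → negLapPow m ζ y = 0) ∧ (∀ y, 2 < ‖y‖ → negLapPow m ζ y = 0) := by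
  have hb : (m : ℝ) - N / 2 < 0 := by
    have : (2 * m : ℝ) < N := by exact_mod_cast hN
    linarith
  let χ : ContDiffBump (0 : EuclideanSpace ℝ (Fin N)) := ⟨1, 2, one_pos, one_lt_two⟩
  have hout : ∀ y : EuclideanSpace ℝ (Fin N), 2 < ‖y‖ → χ y = 0 := fun y hy =>
    χ.zero_of_le_dist (by simpa [χ] using hy.le)
  have hin : ∀ y : EuclideanSpace ℝ (Fin N), ‖y‖ < 1 → χ y = 1 := fun y hy =>
    χ.one_of_mem_closedBall (by simpa [χ] using hy.le)
  have hnear1 : ∀ y : EuclideanSpace ℝ (Fin N), ‖y‖ < 1 →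
      (fun y => χ y + (1 - χ y) * (‖y‖ ^ 2) ^ ((m : ℝ) - N / 2)) =ᶠ[nhds y] fun _ => 1 := by
    intro y hy
    filter_upwards [(isOpen_lt continuous_norm continuous_const).mem_nhds hy] with z hz
    rw [hin z hz]; ring
  have hnear2 : ∀ y : EuclideanSpace ℝ (Fin N), 2 < ‖y‖ →
      (fun y => χ y + (1 - χ y) * (‖y‖ ^ 2) ^ ((m : ℝ) - N / 2)) =ᶠ[nhds y]
        fun y => (‖y‖ ^ 2) ^ ((m : ℝ) - N / 2) := by
    intro y hy
    filter_upwards [(isOpen_lt continuous_const continuous_norm).mem_nhds hy] with z hz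
    rw [hout z hz]; ring
  refine ⟨fun y => χ y + (1 - χ y) * (‖y‖ ^ 2) ^ ((m : ℝ) - N / 2), ?_, ?_, ?_, ?_, ?_, ?_⟩
  · rw [contDiff_iff_contDiffAt]
    intro x
    by_cases hx : x = 0
    · subst hx
      exact contDiffAt_const.congr_of_eventuallyEq (hnear1 0 (by simp))
    · have hsq : ‖x‖ ^ 2 ≠ 0 := by positivity
      exact χ.contDiffAt.add ((contDiffAt_const.sub χ.contDiffAt).mul
        ((contDiff_norm_sq ℝ).contDiffAt.rpow_const_of_ne hsq))
  · intro y
    have h1 : 0 ≤ χ y := χ.nonneg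
    have h2 : χ y ≤ 1 := χ.le_one
    have h3 : 0 ≤ (‖y‖ ^ 2) ^ ((m : ℝ) - N / 2) := by positivity
    have h4 := mul_nonneg (sub_nonneg.2 h2) h3
    simp only
    linarith
  · intro y hy
    exact (hnear2 y hy).eq_of_nhds
  · refine ⟨4 ^ ((m : ℝ) - N / 2), by positivity, fun y hy => ?_⟩
    have hc1 : (4 : ℝ) ^ ((m : ℝ) - N / 2) ≤ 1 :=
      Real.rpow_le_one_of_one_le_of_nonpos (by norm_num) hb.le
    by_cases hy0 : y = 0
    · subst hy0
      exact hc1.trans_eq (hnear1 0 (by simp)).eq_of_nhds.symm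
    · have h1 : 0 ≤ χ y := χ.nonneg
      have h2 : χ y ≤ 1 := χ.le_one
      have hsq : 0 < ‖y‖ ^ 2 := by positivity
      have h3 : (4 : ℝ) ^ ((m : ℝ) - N / 2) ≤ (‖y‖ ^ 2) ^ ((m : ℝ) - N / 2) :=
        Real.rpow_le_rpow_of_nonpos hsq (by nlinarith [norm_nonneg y]) hb.le
      simp only
      nlinarith [mul_nonneg h1 (sub_nonneg.2 hc1), mul_nonneg (sub_nonneg.2 h2) (sub_nonneg.2 h3)]
  · intro y hy
    rw [(negLapPow_congr m (hnear1 y hy)).eq_of_nhds, negLapPow_const hm]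
  · intro y hy
    rw [(negLapPow_congr m (hnear2 y hy)).eq_of_nhds]
    exact negLapPow_norm_sq_rpow_eq_zero hm (by rintro rfl; simp at hy; linarith)

lemma exists_test_function {m : ℕ} (hm : 1 ≤ m) (hN : 2 * m < N) :
    ∃ C : ℝ, 0 < C ∧ ∀ R : ℝ, 0 < R → ∃ C' : ℝ, 0 ≤ C' ∧ ∀ S : ℝ, 4 * R ≤ S →
      ∃ φ : EuclideanSpace ℝ (Fin N) → ℝ, ContDiff ℝ (⊤ : ℕ∞) φ ∧ HasCompactSupport φ ∧
        (∀ x, 0 ≤ φ x) ∧ (∀ x ∈ closedBall (0 : EuclideanSpace ℝ (Fin N)) (2 * R), 1 ≤ φ x) ∧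
        ∀ x, negLapPow m φ x ≤ (annulus N R).indicator (fun _ => C / R ^ (2 * m)) x
          + (annulus N S).indicator (fun _ => C' / S ^ N) x := by
  obtain ⟨ζ, hζs, hζ0, hζout, ⟨c, hc, hζc⟩, hDin, hDout⟩ :=
    exists_smoothed_fundamental_solution hm hN
  let χ : ContDiffBump (0 : EuclideanSpace ℝ (Fin N)) := ⟨1, 2, one_pos, one_lt_two⟩
  have hout : ∀ y : EuclideanSpace ℝ (Fin N), 2 < ‖y‖ → χ y = 0 := fun y hy =>
    χ.zero_of_le_dist (by simpa [χ] using hy.le)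
  have hin : ∀ y : EuclideanSpace ℝ (Fin N), ‖y‖ ≤ 1 → χ y = 1 := fun y hy =>
    χ.one_of_mem_closedBall (by simpa [χ] using hy)
  let h : EuclideanSpace ℝ (Fin N) → ℝ := fun y => ζ ((4 : ℝ) • y) * χ y
  have hhs : ContDiff ℝ (⊤ : ℕ∞) h :=
    (hζs.comp (contDiff_const_smul (4 : ℝ))).mul χ.contDiff
  have hDh : ∀ y, 2 < ‖y‖ → negLapPow m h y = 0 := by
    intro y hy
    have : h =ᶠ[nhds y] fun _ => 0 := by
      filter_upwards [(isOpen_lt continuous_const continuous_norm).mem_nhds hy] with z hz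
      simp [h, hout z hz]
    rw [(negLapPow_congr m this).eq_of_nhds, negLapPow_const hm]
  obtain ⟨C₁, hC₁, hC₁b⟩ := exists_bound_negLapPow m hζs
  obtain ⟨C₂, hC₂, hC₂b⟩ := exists_bound_negLapPow m hhs
  refine ⟨c⁻¹ * C₁, by positivity, fun R hR => ?_⟩
  set b : ℝ := (m : ℝ) - N / 2 with hb
  refine ⟨c⁻¹ * ((4 * R) ^ 2) ^ (-b) * C₂, by positivity, fun S hS => ?_⟩
  have hS0 : 0 < S := by linarith
  have hind1 : ∀ x, 0 ≤ (annulus N R).indicator (fun _ => c⁻¹ * C₁ / R ^ (2 * m)) x :=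
    fun x => Set.indicator_nonneg (fun _ _ => by positivity) x
  have hind2 : ∀ x, 0 ≤ (annulus N S).indicator
      (fun _ => c⁻¹ * ((4 * R) ^ 2) ^ (-b) * C₂ / S ^ N) x :=
    fun x => Set.indicator_nonneg (fun _ _ => by positivity) x
  have hnormR : ∀ x : EuclideanSpace ℝ (Fin N), ‖R⁻¹ • x‖ = ‖x‖ / R := fun x => by
    rw [norm_smul, norm_inv, Real.norm_of_nonneg hR.le]; ring
  have hnormS : ∀ x : EuclideanSpace ℝ (Fin N), ‖S⁻¹ • x‖ = ‖x‖ / S := fun x => by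
    rw [norm_smul, norm_inv, Real.norm_of_nonneg hS0.le]; ring
  refine ⟨fun x => c⁻¹ * (ζ (R⁻¹ • x) * χ (S⁻¹ • x)), ?_, ?_, ?_, ?_, ?_⟩
  · exact contDiff_const.mul ((hζs.comp (contDiff_const_smul _)).mul
      (χ.contDiff.comp (contDiff_const_smul _)))
  · refine HasCompactSupport.intro (isCompact_closedBall (0 : EuclideanSpace ℝ (Fin N)) (2 * S))
      fun x hx => ?_
    have hx' : 2 * S < ‖x‖ := by simpa using hx
    rw [hout (S⁻¹ • x) (by rw [hnormS, lt_div_iff₀ hS0]; exact hx')]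
    simp
  · intro x
    have h1 : 0 ≤ χ (S⁻¹ • x) := χ.nonneg
    have h2 := hζ0 (R⁻¹ • x)
    positivity
  · intro x hx
    have hx' : ‖x‖ ≤ 2 * R := by simpa using hx
    have h1 : c ≤ ζ (R⁻¹ • x) := hζc _ (by rw [hnormR, div_le_iff₀ hR]; exact hx')
    have h2 : χ (S⁻¹ • x) = 1 := hin _ (by rw [hnormS, div_le_iff₀ hS0]; linarith)
    beta_reduce
    rw [h2, mul_one, inv_mul_eq_div, le_div_iff₀ hc, one_mul]
    exact h1
  · intro x
    rcases lt_or_ge ‖x‖ S with hxS | hxS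
    · have hloc : (fun x => c⁻¹ * (ζ (R⁻¹ • x) * χ (S⁻¹ • x))) =ᶠ[nhds x]
          fun x => c⁻¹ * ζ (R⁻¹ • x) := by
        filter_upwards [(isOpen_lt continuous_norm continuous_const).mem_nhds hxS] with z hz
        rw [hin (S⁻¹ • z) (by rw [hnormS, div_le_iff₀ hS0, one_mul]; exact hz.le), mul_one]
      rw [(negLapPow_congr m hloc).eq_of_nhds, negLapPow_const_mul_comp_smul]
      refine le_trans ?_ (le_add_of_nonneg_right (hind2 x))
      by_cases hxR : x ∈ annulus N R
      · rw [Set.indicator_of_mem hxR]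
        have := hC₁b (R⁻¹ • x) (by
          rw [mem_closedBall_zero_iff, hnormR, div_le_iff₀ hR]; exact hxR.2)
        calc c⁻¹ * R⁻¹ ^ (2 * m) * negLapPow m ζ (R⁻¹ • x)
            ≤ c⁻¹ * R⁻¹ ^ (2 * m) * C₁ := by gcongr
          _ = c⁻¹ * C₁ / R ^ (2 * m) := by rw [inv_pow]; ring
      · rw [Set.indicator_of_notMem hxR]
        have : negLapPow m ζ (R⁻¹ • x) = 0 := by
          rcases lt_or_ge ‖x‖ R with h1 | h1
          · exact hDin _ (by rw [hnormR, div_lt_iff₀ hR]; linarith)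
          · have h2 : 2 * R < ‖x‖ := by
              by_contra hcon
              exact hxR ⟨h1, not_lt.1 hcon⟩
            exact hDout _ (by rw [hnormR, lt_div_iff₀ hR]; exact h2)
        beta_reduce
        rw [this, mul_zero]
    · have hloc : (fun x => c⁻¹ * (ζ (R⁻¹ • x) * χ (S⁻¹ • x))) =ᶠ[nhds x]
          fun x => (c⁻¹ * (S ^ 2 / (4 * R) ^ 2) ^ b) * h (S⁻¹ • x) := by
        filter_upwards [(isOpen_lt continuous_const continuous_norm).mem_nhds
          (show S / 2 < ‖x‖ by linarith)] with z hz
        have hz' : S / 2 < ‖z‖ := hz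
        have e1 : ζ (R⁻¹ • z) = (‖z‖ ^ 2 / R ^ 2) ^ b := by
          rw [hζout _ (by rw [hnormR, lt_div_iff₀ hR]; linarith), hnormR, div_pow]
        have e2 : ζ ((4 : ℝ) • S⁻¹ • z) = (16 * ‖z‖ ^ 2 / S ^ 2) ^ b := by
          have hn : ‖(4 : ℝ) • S⁻¹ • z‖ = 4 * (‖z‖ / S) := by
            rw [norm_smul, hnormS]; norm_num
          have hlt : 2 < 4 * (‖z‖ / S) := by
            have : 1 / 2 < ‖z‖ / S := by rw [lt_div_iff₀ hS0]; linarith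
            linarith
          rw [hζout _ (by rw [hn]; exact hlt), hn]
          congr 1
          ring
        have e3 : (‖z‖ ^ 2 / R ^ 2) ^ b
            = (S ^ 2 / (4 * R) ^ 2) ^ b * (16 * ‖z‖ ^ 2 / S ^ 2) ^ b := by
          rw [← Real.mul_rpow (by positivity) (by positivity)]
          congr 1
          field_simp
          norm_num
        simp only [h]
        rw [e1, e2, e3]
        ring
      rw [(negLapPow_congr m hloc).eq_of_nhds, negLapPow_const_mul_comp_smul]
      refine le_trans ?_ (le_add_of_nonneg_left (hind1 x))
      by_cases hx2 : ‖x‖ ≤ 2 * S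
      · rw [Set.indicator_of_mem (show x ∈ annulus N S from ⟨hxS, hx2⟩)]
        have := hC₂b (S⁻¹ • x) (by
          rw [mem_closedBall_zero_iff, hnormS, div_le_iff₀ hS0]; exact hx2)
        have e4 : (S ^ 2) ^ b = S ^ (2 * m) / S ^ N := by
          rw [← Real.rpow_natCast S 2, ← Real.rpow_mul hS0.le, ← Real.rpow_natCast S (2 * m),
            ← Real.rpow_natCast S N, ← Real.rpow_sub hS0]
          congr 1
          push_cast
          rw [hb]; ring
        calc c⁻¹ * (S ^ 2 / (4 * R) ^ 2) ^ b * S⁻¹ ^ (2 * m) * negLapPow m h (S⁻¹ • x)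
            ≤ c⁻¹ * (S ^ 2 / (4 * R) ^ 2) ^ b * S⁻¹ ^ (2 * m) * C₂ := by gcongr
          _ = c⁻¹ * ((4 * R) ^ 2) ^ (-b) * C₂ / S ^ N := by
            rw [Real.div_rpow (by positivity) (by positivity), e4, Real.rpow_neg (by positivity), inv_pow]
            field_simp
      · beta_reduce
        rw [hDh _ (by rw [hnormS, lt_div_iff₀ hS0]; exact not_le.1 hx2), mul_zero]
        exact Set.indicator_nonneg (fun _ _ => by positivity) x

end TestFunction

section Estimates

variable {N : ℕ}

lemma isClosed_annulus (R : ℝ) : IsClosed (annulus N R) :=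
  (isClosed_le continuous_const continuous_norm).inter
    (isClosed_le continuous_norm continuous_const)

lemma annulus_subset_closedBall (R : ℝ) :
    annulus N R ⊆ closedBall (0 : EuclideanSpace ℝ (Fin N)) (2 * R) :=
  fun _ hx => mem_closedBall_zero_iff.2 hx.2

lemma exists_volume_annulus_le (N : ℕ) :
    ∃ κ : ℝ, 0 < κ ∧ ∀ R : ℝ, 0 < R → volume.real (annulus N R) ≤ κ * R ^ N := by
  refine ⟨2 ^ N * volume.real (ball (0 : EuclideanSpace ℝ (Fin N)) 1) + 1, by positivity,
    fun R hR => ?_⟩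
  have h1 : volume.real (annulus N R)
      ≤ volume.real (closedBall (0 : EuclideanSpace ℝ (Fin N)) (2 * R)) :=
    measureReal_mono (annulus_subset_closedBall R) measure_closedBall_lt_top.ne
  have h2 := Measure.addHaar_real_closedBall (volume : Measure (EuclideanSpace ℝ (Fin N)))
    (0 : EuclideanSpace ℝ (Fin N)) (show 0 ≤ 2 * R by positivity)
  rw [finrank_euclideanSpace_fin, mul_pow] at h2
  have h3 : 0 < R ^ N := by positivity
  nlinarith

lemma setIntegral_nonneg_of_nonneg {f : EuclideanSpace ℝ (Fin N) → ℝ} (hf : ∀ x, 0 ≤ f x)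
    (A : Set (EuclideanSpace ℝ (Fin N))) : 0 ≤ ∫ x in A, f x :=
  integral_nonneg hf

lemma Continuous.integrableOn_of_subset_closedBall {f : EuclideanSpace ℝ (Fin N) → ℝ}
    (hf : Continuous f) {A : Set (EuclideanSpace ℝ (Fin N))} {ρ : ℝ}
    (hA : A ⊆ closedBall (0 : EuclideanSpace ℝ (Fin N)) ρ) : IntegrableOn f A :=
  (hf.continuousOn.integrableOn_compact (isCompact_closedBall _ _)).mono_set hA

lemma setIntegral_const_add_const_mul {f : EuclideanSpace ℝ (Fin N) → ℝ} (hf : Continuous f)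
    {A : Set (EuclideanSpace ℝ (Fin N))} {ρ : ℝ}
    (hA : A ⊆ closedBall (0 : EuclideanSpace ℝ (Fin N)) ρ) (a b : ℝ) :
    ∫ x in A, (a + b * f x) = volume.real A * a + b * ∫ x in A, f x := by
  have h1 : IntegrableOn (fun _ => a) A :=
    (continuous_const (y := a)).integrableOn_of_subset_closedBall hA
  have h2 : IntegrableOn (fun x => b * f x) A :=
    (hf.const_mul b).integrableOn_of_subset_closedBall hA
  rw [integral_add h1 h2, setIntegral_const, integral_const_mul, smul_eq_mul]

lemma rpow_setIntegral_le {u : EuclideanSpace ℝ (Fin N) → ℝ} (hu : Continuous u)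
    (hu0 : ∀ x, 0 ≤ u x) {A : Set (EuclideanSpace ℝ (Fin N))} {ρ : ℝ}
    (hA : A ⊆ closedBall (0 : EuclideanSpace ℝ (Fin N)) ρ) {p V : ℝ} (hp : 1 ≤ p) (hV : 0 < V)
    (hAV : volume.real A ≤ V) :
    (∫ x in A, u x) ^ p * V ^ (1 - p) ≤ ∫ x in A, u x ^ p := by
  have hup : Continuous fun x => u x ^ p := hu.rpow_const fun x => Or.inr (by linarith)
  set I := ∫ x in A, u x with hI
  have hI0 : 0 ≤ I := setIntegral_nonneg_of_nonneg hu0 A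
  rcases hI0.eq_or_lt with h0 | hIpos
  · rw [← h0, Real.zero_rpow (by linarith), zero_mul]
    exact setIntegral_nonneg_of_nonneg (fun x => Real.rpow_nonneg (hu0 x) p) A
  set t := I / V with ht
  have htpos : 0 < t := by positivity
  have hpt : ∀ x, t ^ p * (1 - p) + t ^ p * (p / t) * u x ≤ u x ^ p := by
    intro x
    have hx : 0 ≤ u x / t := div_nonneg (hu0 x) htpos.le
    have h1 := one_add_mul_self_le_rpow_one_add (show -1 ≤ u x / t - 1 by linarith) hp
    rw [show 1 + (u x / t - 1) = u x / t by ring, Real.div_rpow (hu0 x) htpos.le,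
      le_div_iff₀ (by positivity)] at h1
    calc t ^ p * (1 - p) + t ^ p * (p / t) * u x = (1 + p * (u x / t - 1)) * t ^ p := by ring
      _ ≤ u x ^ p := h1
  have hint : IntegrableOn (fun x => t ^ p * (1 - p) + t ^ p * (p / t) * u x) A :=
    (continuous_const.add (continuous_const.mul hu)).integrableOn_of_subset_closedBall hA
  have hmono := setIntegral_mono hint (hup.integrableOn_of_subset_closedBall hA) hpt
  have hcomp : ∫ x in A, (t ^ p * (1 - p) + t ^ p * (p / t) * u x)
      = volume.real A * (t ^ p * (1 - p)) + t ^ p * (p / t) * I :=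
    setIntegral_const_add_const_mul hu hA _ _
  have hItV : I = t * V := by rw [ht]; field_simp
  have htp : 0 < t ^ p := by positivity
  have hfin : I ^ p * V ^ (1 - p) = V * t ^ p := by
    rw [hItV, Real.mul_rpow htpos.le hV.le, mul_assoc, ← Real.rpow_add hV]
    simp [mul_comm]
  have h5 : t ^ p * (p / t) * I = t ^ p * p * V := by
    rw [hItV]; field_simp
  rw [hcomp, h5] at hmono
  rw [hfin]
  nlinarith [mul_nonneg (mul_nonneg htp.le (sub_nonneg.2 hp)) (sub_nonneg.2 hAV)]

lemma tendsto_annulus_average {u : EuclideanSpace ℝ (Fin N) → ℝ} (hu : Continuous u)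
    (hu0 : ∀ x, 0 ≤ u x) {p : ℝ} (hp : 1 ≤ p) {Ψ : ℝ → ℝ} (hK : CondK N Ψ)
    (hint : IntegrableOn (fun y : EuclideanSpace ℝ (Fin N) => u y ^ p * Ψ (‖y‖ / 2))
      {y | 1 < ‖y‖}) :
    Tendsto (fun S : ℝ => (∫ x in annulus N S, u x) / S ^ N) atTop (nhds 0) := by
  obtain ⟨κ, hκ, hvol⟩ := exists_volume_annulus_le N
  have hup : Continuous fun x => u x ^ p := hu.rpow_const fun x => Or.inr (by linarith)
  set M := ∫ y in {y : EuclideanSpace ℝ (Fin N) | 1 < ‖y‖}, u y ^ p * Ψ (‖y‖ / 2) with hM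
  have hmeas : MeasurableSet {y : EuclideanSpace ℝ (Fin N) | 1 < ‖y‖} :=
    measurableSet_lt measurable_const measurable_norm
  have hpow : ∀ S : ℝ, 1 < S → ∫ x in annulus N S, u x ^ p ≤ M / Ψ S := by
    intro S hS
    have hΨ : 0 < Ψ S := hK.pos S (by linarith)
    have hsub : annulus N S ⊆ {y : EuclideanSpace ℝ (Fin N) | 1 < ‖y‖} :=
      fun y hy => lt_of_lt_of_le hS hy.1
    have h1 : ∫ x in annulus N S, u x ^ p * Ψ S ≤ ∫ x in annulus N S, u x ^ p * Ψ (‖x‖ / 2) := by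
      refine setIntegral_mono_on
        ((hup.mul continuous_const).integrableOn_of_subset_closedBall (annulus_subset_closedBall S))
        (hint.mono_set hsub) (isClosed_annulus S).measurableSet fun x hx => ?_
      have hx1 : 0 < ‖x‖ := by linarith [hx.1]
      exact mul_le_mul_of_nonneg_left (hK.anti (Set.mem_Ioi.2 (by linarith))
        (Set.mem_Ioi.2 (by linarith)) (by linarith [hx.2])) (Real.rpow_nonneg (hu0 x) p)
    have h2 : ∫ x in annulus N S, u x ^ p * Ψ (‖x‖ / 2) ≤ M := by
      refine setIntegral_mono_set hint ?_ hsub.eventuallyLE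
      filter_upwards [ae_restrict_mem hmeas] with y hy
      have hy' : 1 < ‖y‖ := hy
      exact mul_nonneg (Real.rpow_nonneg (hu0 y) p) (hK.pos _ (by linarith)).le
    rw [integral_mul_const] at h1
    rw [le_div_iff₀ hΨ]
    exact h1.trans h2
  have hsmall : Tendsto (fun S : ℝ => M / (S ^ N * Ψ S)) atTop (nhds 0) :=
    hK.tendsto.const_div_atTop M
  rw [Metric.tendsto_nhds]
  intro δ hδ
  set ε := δ / (2 * κ) with hε
  have hεpos : 0 < ε := by positivity
  have hc : 0 < ε ^ (p - 1) := by positivity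
  have hev : ∀ᶠ S : ℝ in atTop, M / (S ^ N * Ψ S) < ε ^ (p - 1) * (δ / 2) :=
    hsmall.eventually_lt_const (by positivity)
  filter_upwards [hev, eventually_gt_atTop 1] with S hS hS1
  have hS0 : 0 < S := by linarith
  have hSN : 0 < S ^ N := by positivity
  have hΨ : 0 < Ψ S := hK.pos S hS0
  have hI0 : 0 ≤ ∫ x in annulus N S, u x := setIntegral_nonneg_of_nonneg hu0 _
  have hpt : ∀ x, u x ≤ ε + (ε ^ (p - 1))⁻¹ * u x ^ p := by
    intro x
    have hxp : 0 ≤ u x ^ p := Real.rpow_nonneg (hu0 x) p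
    rcases le_or_gt (u x) ε with h | h
    · have : 0 ≤ (ε ^ (p - 1))⁻¹ * u x ^ p := by positivity
      linarith
    · have hux : 0 < u x := hεpos.trans h
      have h1 : ε ^ (p - 1) ≤ u x ^ (p - 1) :=
        Real.rpow_le_rpow hεpos.le h.le (by linarith)
      have h2 : u x ^ p = u x ^ (p - 1) * u x := by
        rw [← Real.rpow_add_one hux.ne']; congr 1; ring
      have h3 : u x ≤ (ε ^ (p - 1))⁻¹ * u x ^ p := by
        rw [inv_mul_eq_div, le_div_iff₀ hc, h2, mul_comm]
        gcongr
      linarith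
  have hsub := annulus_subset_closedBall (N := N) S
  have h1 : ∫ x in annulus N S, u x
      ≤ ∫ x in annulus N S, (ε + (ε ^ (p - 1))⁻¹ * u x ^ p) :=
    setIntegral_mono (hu.integrableOn_of_subset_closedBall hsub)
      ((continuous_const.add (continuous_const.mul hup)).integrableOn_of_subset_closedBall hsub) hpt
  rw [setIntegral_const_add_const_mul hup hsub] at h1
  have h2 : volume.real (annulus N S) * ε ≤ δ / 2 * S ^ N := by
    calc volume.real (annulus N S) * ε ≤ κ * S ^ N * ε := by gcongr; exact hvol S hS0
      _ = δ / 2 * S ^ N := by rw [hε]; field_simp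
  have h3 : (ε ^ (p - 1))⁻¹ * ∫ x in annulus N S, u x ^ p < δ / 2 * S ^ N := by
    rw [inv_mul_eq_div, div_lt_iff₀ hc]
    refine (hpow S hS1).trans_lt ?_
    rw [← div_div, div_right_comm, div_lt_iff₀ hSN] at hS
    linarith
  rw [Real.dist_eq, sub_zero, abs_of_nonneg (by positivity), div_lt_iff₀ hSN]
  linarith

lemma exists_setIntegral_negLapPow_le {m : ℕ} (hm : 1 ≤ m) (hN : 2 * m < N) :
    ∃ C : ℝ, 0 < C ∧ ∀ u : EuclideanSpace ℝ (Fin N) → ℝ, ContDiff ℝ (2 * m) u → (∀ x, 0 ≤ u x) →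
      (∀ x, 0 ≤ negLapPow m u x) →
      Tendsto (fun S : ℝ => (∫ x in annulus N S, u x) / S ^ N) atTop (nhds 0) →
      ∀ R : ℝ, 0 < R → ∫ x in closedBall (0 : EuclideanSpace ℝ (Fin N)) (2 * R), negLapPow m u x
        ≤ C * ((∫ x in annulus N R, u x) / R ^ (2 * m)) := by
  obtain ⟨C, hC, htest⟩ := exists_test_function (N := N) hm hN
  refine ⟨C, hC, fun u hu hu0 hw0 hlim R hR => ?_⟩
  obtain ⟨C', hC', htest⟩ := htest R hR
  have hwc : Continuous (negLapPow m u) := continuous_negLapPow m hu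
  have hbound : ∀ S : ℝ, 4 * R ≤ S →
      ∫ x in closedBall (0 : EuclideanSpace ℝ (Fin N)) (2 * R), negLapPow m u x
        ≤ C * ((∫ x in annulus N R, u x) / R ^ (2 * m))
          + C' * ((∫ x in annulus N S, u x) / S ^ N) := by
    intro S hS
    obtain ⟨φ, hφ, hφc, hφ0, hφ1, hφD⟩ := htest S hS
    have hi1 : Integrable fun x => negLapPow m u x * φ x :=
      (hwc.mul hφ.continuous).integrable_of_hasCompactSupport hφc.mul_left
    have h1 : ∫ x in closedBall (0 : EuclideanSpace ℝ (Fin N)) (2 * R), negLapPow m u x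
        ≤ ∫ x in closedBall (0 : EuclideanSpace ℝ (Fin N)) (2 * R), negLapPow m u x * φ x :=
      setIntegral_mono_on (hwc.integrableOn_of_subset_closedBall subset_rfl) hi1.integrableOn
        isClosed_closedBall.measurableSet fun x hx => le_mul_of_one_le_right (hw0 x) (hφ1 x hx)
    have h2 : ∫ x in closedBall (0 : EuclideanSpace ℝ (Fin N)) (2 * R), negLapPow m u x * φ x
        ≤ ∫ x, negLapPow m u x * φ x :=
      setIntegral_le_integral hi1 (ae_of_all _ fun x => mul_nonneg (hw0 x) (hφ0 x))
    have hi2 : Integrable fun x => u x * negLapPow m φ x :=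
      (hu.continuous.mul (contDiff_negLapPow m hφ).continuous).integrable_of_hasCompactSupport
        (hφc.negLapPow m).mul_left
    have hi3 : ∀ (ρ a : ℝ), Integrable ((annulus N ρ).indicator fun x => u x * a) := fun ρ a =>
      ((hu.continuous.mul continuous_const).integrableOn_of_subset_closedBall
        (annulus_subset_closedBall ρ)).integrable_indicator (isClosed_annulus ρ).measurableSet
    have h3 : ∫ x, u x * negLapPow m φ x
        ≤ ∫ x, ((annulus N R).indicator (fun x => u x * (C / R ^ (2 * m))) x
          + (annulus N S).indicator (fun x => u x * (C' / S ^ N)) x) := by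
      refine integral_mono hi2 ((hi3 _ _).add (hi3 _ _)) fun x => ?_
      refine (mul_le_mul_of_nonneg_left (hφD x) (hu0 x)).trans_eq ?_
      rw [mul_add]
      congr 1 <;> exact (Set.indicator_const_mul _ _ _ _).symm
    rw [integral_add (hi3 _ _) (hi3 _ _), integral_indicator (isClosed_annulus R).measurableSet,
      integral_indicator (isClosed_annulus S).measurableSet, integral_mul_const,
      integral_mul_const] at h3
    rw [← integral_negLapPow_mul m hu hφ hφc] at h3
    calc _ ≤ _ := (h1.trans h2).trans h3
      _ = _ := by ring
  have hlim' : Tendsto (fun S : ℝ => C * ((∫ x in annulus N R, u x) / R ^ (2 * m))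
      + C' * ((∫ x in annulus N S, u x) / S ^ N)) atTop
      (nhds (C * ((∫ x in annulus N R, u x) / R ^ (2 * m)) + C' * 0)) :=
    (hlim.const_mul C').const_add _
  rw [mul_zero, add_zero] at hlim'
  exact ge_of_tendsto hlim' (eventually_ge_atTop (4 * R) |>.mono hbound)

lemma CondK.ae_nonneg_mul [NeZero N] {Ψ : ℝ → ℝ} (hK : CondK N Ψ) {f : EuclideanSpace ℝ (Fin N) → ℝ}
    (hf : ∀ x, 0 ≤ f x) (x : EuclideanSpace ℝ (Fin N)) : ∀ᵐ y, 0 ≤ f y * Ψ ‖y - x‖ := by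
  filter_upwards [Measure.ae_ne volume x] with y hy
  exact mul_nonneg (hf y) (hK.pos _ (norm_pos_iff.2 (sub_ne_zero.2 hy))).le

lemma CondK.integrable_mul_comp_sub {Ψ : ℝ → ℝ} (hK : CondK N Ψ)
    {f : EuclideanSpace ℝ (Fin N) → ℝ} (hfc : Continuous f) (hf : ∀ x, 0 ≤ f x)
    (hint : IntegrableOn (fun y : EuclideanSpace ℝ (Fin N) => f y * Ψ (‖y‖ / 2)) {y | 1 < ‖y‖})
    (x : EuclideanSpace ℝ (Fin N)) : Integrable fun y => f y * Ψ ‖y - x‖ := by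
  set ρ := max 1 (2 * ‖x‖) with hρ
  have hρ1 : 1 ≤ ρ := le_max_left _ _
  have hρ2 : 2 * ‖x‖ ≤ ρ := le_max_right _ _
  have hmeasΨ : AEStronglyMeasurable (fun y : EuclideanSpace ℝ (Fin N) => Ψ ‖y - x‖) volume :=
    hK.locInt.aestronglyMeasurable.comp_measurePreserving (measurePreserving_sub_right volume x)
  have hmeas : AEStronglyMeasurable (fun y => f y * Ψ ‖y - x‖) volume :=
    hfc.aestronglyMeasurable.mul hmeasΨ
  have hin : IntegrableOn (fun y => f y * Ψ ‖y - x‖) (closedBall 0 ρ) := by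
    have h1 : IntegrableOn (fun y : EuclideanSpace ℝ (Fin N) => Ψ ‖y - x‖) (closedBall 0 ρ) := by
      have h2 := (hK.locInt.integrableOn_isCompact
        ((isCompact_closedBall (0 : EuclideanSpace ℝ (Fin N)) ρ).image
          (continuous_id.sub continuous_const : Continuous fun y => id y - x)))
      have h3 := (measurePreserving_sub_right volume x).integrableOn_comp_preimage
        (MeasurableEquiv.subRight x).measurableEmbedding |>.2 h2
      exact h3.mono_set fun y hy => ⟨y, hy, rfl⟩
    exact h1.continuousOn_mul hfc.continuousOn (isCompact_closedBall _ _)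
  have hout : IntegrableOn (fun y => f y * Ψ ‖y - x‖) (closedBall 0 ρ)ᶜ := by
    have hsub : (closedBall (0 : EuclideanSpace ℝ (Fin N)) ρ)ᶜ ⊆ {y | 1 < ‖y‖} := by
      intro y hy
      have hy' : ρ < ‖y‖ := by simpa using hy
      exact lt_of_le_of_lt hρ1 hy'
    refine (hint.mono_set hsub).mono' hmeas.restrict ?_
    filter_upwards [ae_restrict_mem isClosed_closedBall.measurableSet.compl] with y hy
    have hy' : ρ < ‖y‖ := by simpa using hy
    have h1 : ‖y‖ / 2 ≤ ‖y - x‖ := by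
      have := norm_sub_norm_le y x
      linarith
    have h2 : 0 < ‖y‖ / 2 := by linarith
    have h3 : Ψ ‖y - x‖ ≤ Ψ (‖y‖ / 2) := hK.anti h2 (h2.trans_le h1) h1
    rw [Real.norm_of_nonneg (mul_nonneg (hf y) (hK.pos _ (h2.trans_le h1)).le)]
    exact mul_le_mul_of_nonneg_left h3 (hf y)
  rw [← integrableOn_univ, ← Set.union_compl_self (closedBall (0 : EuclideanSpace ℝ (Fin N)) ρ)]
  exact hin.union hout

lemma CondK.mul_setIntegral_le [NeZero N] {Ψ : ℝ → ℝ} (hK : CondK N Ψ)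
    {f : EuclideanSpace ℝ (Fin N) → ℝ} (hfc : Continuous f) (hf : ∀ x, 0 ≤ f x)
    (hint : IntegrableOn (fun y : EuclideanSpace ℝ (Fin N) => f y * Ψ (‖y‖ / 2)) {y | 1 < ‖y‖})
    {R : ℝ} {A : Set (EuclideanSpace ℝ (Fin N))}
    (hA : A ⊆ closedBall (0 : EuclideanSpace ℝ (Fin N)) (2 * R)) (hAm : MeasurableSet A)
    {x : EuclideanSpace ℝ (Fin N)} (hx : ‖x‖ ≤ 2 * R) :
    Ψ (4 * R) * ∫ y in A, f y ≤ ∫ y, f y * Ψ ‖y - x‖ := by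
  have hi := hK.integrable_mul_comp_sub hfc hf hint x
  refine le_trans ?_ (setIntegral_le_integral hi (hK.ae_nonneg_mul hf x) (s := A))
  rw [← integral_const_mul]
  refine integral_mono_ae ((continuous_const.mul hfc).integrableOn_of_subset_closedBall hA)
    hi.integrableOn ?_
  filter_upwards [ae_restrict_mem hAm, ae_restrict_of_ae (Measure.ae_ne volume x)] with y hy hyx
  have h1 : 0 < ‖y - x‖ := norm_pos_iff.2 (sub_ne_zero.2 hyx)
  have h2 : ‖y - x‖ ≤ 4 * R := by
    have := norm_sub_le y x
    have h3 : ‖y‖ ≤ 2 * R := mem_closedBall_zero_iff.1 (hA hy)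
    linarith
  rw [mul_comm]
  exact mul_le_mul_of_nonneg_left (hK.anti h1 (h1.trans_le h2) h2) (hf y)

end Estimates

section Pair

variable {N m : ℕ}

lemma mul_setIntegral_mul_setIntegral_le [NeZero N] {u v : EuclideanSpace ℝ (Fin N) → ℝ}
    {p q : ℝ} (hp : 1 ≤ p) (hq : 1 ≤ q) {Ψ : ℝ → ℝ} (hK : CondK N Ψ)
    (hu : ContDiff ℝ (2 * m) u) (hu0 : ∀ x, 0 ≤ u x) (hv : Continuous v) (hv0 : ∀ x, 0 ≤ v x)
    (hint : IntegrableOn (fun y : EuclideanSpace ℝ (Fin N) => v y ^ p * Ψ (‖y‖ / 2)) {y | 1 < ‖y‖})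
    (hineq : ∀ x, (∫ y, v y ^ p * Ψ ‖y - x‖) * u x ^ q ≤ negLapPow m u x)
    {R : ℝ} {A : Set (EuclideanSpace ℝ (Fin N))}
    (hA : A ⊆ closedBall (0 : EuclideanSpace ℝ (Fin N)) (2 * R)) (hAm : MeasurableSet A) :
    Ψ (4 * R) * (∫ x in A, v x ^ p) * ∫ x in A, u x ^ q ≤ ∫ x in A, negLapPow m u x := by
  have hvp : Continuous fun x => v x ^ p := hv.rpow_const fun x => Or.inr (by linarith)
  have huq : Continuous fun x => u x ^ q := hu.continuous.rpow_const fun x => Or.inr (by linarith)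
  rw [← integral_const_mul]
  refine setIntegral_mono_on ((huq.const_mul _).integrableOn_of_subset_closedBall hA)
    ((continuous_negLapPow m hu).integrableOn_of_subset_closedBall hA) hAm fun x hx => ?_
  refine le_trans ?_ (hineq x)
  exact mul_le_mul_of_nonneg_right (hK.mul_setIntegral_le hvp
    (fun y => Real.rpow_nonneg (hv0 y) p) hint hA hAm (mem_closedBall_zero_iff.1 (hA hx)))
    (Real.rpow_nonneg (hu0 x) q)

lemma negLapPow_nonneg_of_le [NeZero N] {u v : EuclideanSpace ℝ (Fin N) → ℝ}
    {p q : ℝ} {Ψ : ℝ → ℝ} (hK : CondK N Ψ) (hu0 : ∀ x, 0 ≤ u x) (hv0 : ∀ x, 0 ≤ v x)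
    (hineq : ∀ x, (∫ y, v y ^ p * Ψ ‖y - x‖) * u x ^ q ≤ negLapPow m u x)
    (x : EuclideanSpace ℝ (Fin N)) : 0 ≤ negLapPow m u x :=
  (mul_nonneg (integral_nonneg_of_ae (hK.ae_nonneg_mul (fun y => Real.rpow_nonneg (hv0 y) p) x))
    (Real.rpow_nonneg (hu0 x) q)).trans (hineq x)

lemma exists_le_setIntegral_annulus_negLapPow (N m : ℕ) [NeZero N] (p q : ℝ) (hp : 1 ≤ p)
    (hq : 1 ≤ q) :
    ∃ c : ℝ, 0 < c ∧ ∀ (Ψ : ℝ → ℝ) (u v : EuclideanSpace ℝ (Fin N) → ℝ), CondK N Ψ →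
      ContDiff ℝ (2 * m) u → (∀ x, 0 ≤ u x) → Continuous v → (∀ x, 0 ≤ v x) →
      IntegrableOn (fun y : EuclideanSpace ℝ (Fin N) => v y ^ p * Ψ (‖y‖ / 2)) {y | 1 < ‖y‖} →
      (∀ x, (∫ y, v y ^ p * Ψ ‖y - x‖) * u x ^ q ≤ negLapPow m u x) →
      ∀ R : ℝ, 0 < R →
        c * ((4 * R) ^ (2 * (N : ℝ) - ((N : ℝ) - 2 * m) * (p + q)) * Ψ (4 * R)) *
          ((∫ x in annulus N R, v x) / R ^ (2 * m)) ^ p *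
          ((∫ x in annulus N R, u x) / R ^ (2 * m)) ^ q ≤ ∫ x in annulus N R, negLapPow m u x := by
  obtain ⟨κ, hκ, hvol⟩ := exists_volume_annulus_le N
  set E : ℝ := 2 * (N : ℝ) - ((N : ℝ) - 2 * m) * (p + q) with hE
  refine ⟨κ ^ (1 - p) * κ ^ (1 - q) * ((4 : ℝ) ^ E)⁻¹, by positivity,
    fun Ψ u v hK hu hu0 hv hv0 hint hineq R hR => ?_⟩
  have hsub := annulus_subset_closedBall (N := N) R
  have hV : 0 < κ * R ^ N := by positivity
  have h4 : 0 < (4 : ℝ) ^ E := by positivity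
  have hΨ : 0 < Ψ (4 * R) := hK.pos _ (by positivity)
  have hI := setIntegral_nonneg_of_nonneg hu0 (annulus N R)
  have hJ := setIntegral_nonneg_of_nonneg hv0 (annulus N R)
  have h1 := rpow_setIntegral_le hv hv0 hsub hp hV (hvol R hR)
  have h2 := rpow_setIntegral_le hu.continuous hu0 hsub hq hV (hvol R hR)
  refine le_trans (le_trans (b := Ψ (4 * R) *
      ((∫ x in annulus N R, v x) ^ p * (κ * R ^ N) ^ (1 - p)) *
      ((∫ x in annulus N R, u x) ^ q * (κ * R ^ N) ^ (1 - q))) (le_of_eq ?_) ?_)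
    (mul_setIntegral_mul_setIntegral_le hp hq hK hu hu0 hv hv0 hint hineq hsub (isClosed_annulus R).measurableSet)
  · rw [Real.div_rpow hJ (by positivity), Real.div_rpow hI (by positivity),
      Real.mul_rpow (by norm_num) hR.le, Real.mul_rpow hκ.le (by positivity),
      Real.mul_rpow hκ.le (by positivity)]
    have hexp : R ^ E = (R ^ N) ^ (1 - p) * (R ^ N) ^ (1 - q) *
        ((R ^ (2 * m)) ^ p * (R ^ (2 * m)) ^ q) := by
      simp only [← Real.rpow_natCast, ← Real.rpow_mul hR.le, ← Real.rpow_add hR]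
      congr 1
      rw [hE]; push_cast; ring
    rw [hexp]
    field_simp
  · have hJp : 0 ≤ ∫ x in annulus N R, v x ^ p :=
      setIntegral_nonneg_of_nonneg (fun x => Real.rpow_nonneg (hv0 x) p) _
    have hIq : 0 ≤ (∫ x in annulus N R, u x) ^ q * (κ * R ^ N) ^ (1 - q) := by positivity
    exact mul_le_mul (mul_le_mul_of_nonneg_left h1 hΨ.le) h2 hIq (mul_nonneg hΨ.le hJp)

lemma exists_pos_le_annulus_average [NeZero N] (hm : 1 ≤ m) (hN : 2 * m < N)
    {u v : EuclideanSpace ℝ (Fin N) → ℝ}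
    {p q : ℝ} (hp : 1 ≤ p) (hq : 1 ≤ q) {Ψ : ℝ → ℝ} (hK : CondK N Ψ)
    (hu : ContDiff ℝ (2 * m) u) (hu0 : ∀ x, 0 ≤ u x) (hv : Continuous v) (hv0 : ∀ x, 0 ≤ v x)
    (hint : IntegrableOn (fun y : EuclideanSpace ℝ (Fin N) => v y ^ p * Ψ (‖y‖ / 2)) {y | 1 < ‖y‖})
    (hineq : ∀ x, (∫ y, v y ^ p * Ψ ‖y - x‖) * u x ^ q ≤ negLapPow m u x)
    (hlim : Tendsto (fun S : ℝ => (∫ x in annulus N S, u x) / S ^ N) atTop (nhds 0))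
    {a b : EuclideanSpace ℝ (Fin N)} (ha : u a ≠ 0) (hb : v b ≠ 0) :
    ∃ δ : ℝ, 0 < δ ∧ ∀ᶠ R : ℝ in atTop, δ ≤ (∫ x in annulus N R, u x) / R ^ (2 * m) := by
  obtain ⟨C, hC, hle⟩ := exists_setIntegral_negLapPow_le hm hN
  have hw0 := negLapPow_nonneg_of_le hK hu0 hv0 hineq
  have hwc := continuous_negLapPow m hu
  set R₀ := 1 + ‖a‖ + ‖b‖ with hR₀
  have hR₀pos : 0 < R₀ := by positivity
  have hvp : Continuous fun x => v x ^ p := hv.rpow_const fun x => Or.inr (by linarith)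
  have huq : Continuous fun x => u x ^ q := hu.continuous.rpow_const fun x => Or.inr (by linarith)
  have hpos : ∀ {f : EuclideanSpace ℝ (Fin N) → ℝ} {s : ℝ} {z : EuclideanSpace ℝ (Fin N)},
      Continuous (fun x => f x ^ s) → (∀ x, 0 ≤ f x) → f z ≠ 0 → ‖z‖ < 2 * R₀ →
      0 < ∫ x in closedBall (0 : EuclideanSpace ℝ (Fin N)) (2 * R₀), f x ^ s := by
    intro f s z hfc hf0 hfz hz
    have hfs : ∀ x, 0 ≤ f x ^ s := fun x => Real.rpow_nonneg (hf0 x) s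
    rw [setIntegral_pos_iff_support_of_nonneg_ae (ae_of_all _ hfs)
      (hfc.integrableOn_of_subset_closedBall subset_rfl)]
    refine lt_of_lt_of_le (IsOpen.measure_pos volume
      ((hfc.isOpen_support).inter (isOpen_ball (x := 0) (ε := 2 * R₀))) ⟨z, ?_, ?_⟩)
      (measure_mono (Set.inter_subset_inter_right _ ball_subset_closedBall))
    · exact (Real.rpow_pos_of_pos (lt_of_le_of_ne (hf0 z) hfz.symm) s).ne'
    · exact mem_ball_zero_iff.2 hz
  have hW : 0 < ∫ x in closedBall (0 : EuclideanSpace ℝ (Fin N)) (2 * R₀), negLapPow m u x := by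
    refine lt_of_lt_of_le ?_ (mul_setIntegral_mul_setIntegral_le hp hq hK hu hu0
      hv hv0 hint hineq subset_rfl isClosed_closedBall.measurableSet)
    refine mul_pos (mul_pos (hK.pos _ (by positivity)) (hpos hvp hv0 hb ?_)) (hpos huq hu0 ha ?_)
    · linarith [norm_nonneg a, norm_nonneg b]
    · linarith [norm_nonneg a, norm_nonneg b]
  refine ⟨_, div_pos hW hC, ?_⟩
  filter_upwards [eventually_ge_atTop R₀] with R hR
  rw [div_le_iff₀' hC]
  refine le_trans ?_ (hle u hu hu0 hw0 hlim R (hR₀pos.trans_le hR))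
  exact setIntegral_mono_set (hwc.integrableOn_of_subset_closedBall subset_rfl)
    (ae_of_all _ hw0) (closedBall_subset_closedBall (by linarith)).eventuallyLE

lemma tendsto_setIntegral_annulus_of_frequently_le [NeZero N]
    {w : EuclideanSpace ℝ (Fin N) → ℝ} (hw : Continuous w) (hw0 : ∀ x, 0 ≤ w x) {B : ℝ}
    (hB : ∃ᶠ R : ℝ in atTop,
      ∫ x in closedBall (0 : EuclideanSpace ℝ (Fin N)) (2 * R), w x ≤ B) :
    Tendsto (fun R : ℝ => ∫ x in annulus N R, w x) atTop (nhds 0) := by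
  set W : ℝ → ℝ := fun ρ => ∫ x in closedBall (0 : EuclideanSpace ℝ (Fin N)) ρ, w x with hW
  have hmono : Monotone W := fun s t hst =>
    setIntegral_mono_set (hw.integrableOn_of_subset_closedBall subset_rfl)
      (ae_of_all _ hw0) (closedBall_subset_closedBall hst).eventuallyLE
  have hbdd : BddAbove (Set.range W) := by
    refine ⟨B, ?_⟩
    rintro _ ⟨ρ, rfl⟩
    obtain ⟨R, hR, hRρ⟩ := (hB.and_eventually (eventually_ge_atTop (max ρ 0))).exists
    have h1 : ρ ≤ R := (le_max_left _ _).trans hRρ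
    have h2 : 0 ≤ R := (le_max_right _ _).trans hRρ
    exact (hmono (by linarith : ρ ≤ 2 * R)).trans hR
  have hlim := tendsto_atTop_ciSup hmono hbdd
  have h1 : Tendsto (fun R : ℝ => W (2 * R)) atTop (nhds (⨆ ρ, W ρ)) :=
    hlim.comp (tendsto_id.const_mul_atTop two_pos)
  have h2 : Tendsto (fun R : ℝ => W (R / 2)) atTop (nhds (⨆ ρ, W ρ)) :=
    hlim.comp (tendsto_id.atTop_div_const two_pos)
  have h3 := h1.sub h2
  rw [sub_self] at h3
  refine tendsto_of_tendsto_of_tendsto_of_le_of_le' tendsto_const_nhds h3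
    (Eventually.of_forall fun R => setIntegral_nonneg_of_nonneg hw0 _) ?_
  filter_upwards [eventually_gt_atTop 0] with R hR
  have hsub : closedBall (0 : EuclideanSpace ℝ (Fin N)) (R / 2) ⊆ closedBall 0 (2 * R) :=
    closedBall_subset_closedBall (by linarith)
  rw [hW]
  beta_reduce
  rw [← setIntegral_sdiff isClosed_closedBall.measurableSet
    (hw.integrableOn_of_subset_closedBall subset_rfl) hsub]
  refine setIntegral_mono_set (hw.integrableOn_of_subset_closedBall Set.sdiff_subset)
    (ae_of_all _ hw0) (Eventually.of_forall fun x hx => ⟨annulus_subset_closedBall R hx, ?_⟩)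
  rw [mem_closedBall_zero_iff, not_le]
  linarith [hx.1]

lemma le_one_add_div_of_mul_rpow_mul_rpow_le {p q c c₁ C δ X s t : ℝ} (hp : 1 ≤ p) (hq : 1 ≤ q)
    (hc₁ : 0 < c₁) (hc : 0 < c) (hδ : 0 < δ) (hX : c ≤ X) (hs : δ ≤ s) (ht : 0 ≤ t)
    (h : c₁ * X * t ^ p * s ^ q ≤ C * s) : t ≤ 1 + C / (c₁ * c * δ ^ (q - 1)) := by
  have hspos : 0 < s := hδ.trans_le hs
  have htp : 0 ≤ t ^ p := Real.rpow_nonneg ht p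
  have hle : t ^ p ≤ C / (c₁ * c * δ ^ (q - 1)) := by
    rw [le_div_iff₀ (by positivity)]
    rw [show s ^ q = s ^ (q - 1) * s by rw [← Real.rpow_add_one hspos.ne']; congr 1; ring,
      ← mul_assoc] at h
    have h1 := le_of_mul_le_mul_right h hspos
    calc t ^ p * (c₁ * c * δ ^ (q - 1)) = c₁ * c * t ^ p * δ ^ (q - 1) := by ring
      _ ≤ c₁ * X * t ^ p * s ^ (q - 1) := by
        have hX0 : 0 ≤ X := hc.le.trans hX
        have hq' : 0 ≤ q - 1 := sub_nonneg.2 hq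
        gcongr
      _ ≤ C := h1
  rcases le_total t 1 with h1 | h1
  · have : 0 ≤ C / (c₁ * c * δ ^ (q - 1)) := htp.trans hle
    linarith
  · have := Real.self_le_rpow_of_one_le h1 hp
    linarith

/-- Two-component case: one of the two functions vanishes identically. -/
lemma eq_zero_or_eq_zero_of_le_negLapPow [NeZero N] (hm : 1 ≤ m) (hN : 2 * m < N)
    {u v : EuclideanSpace ℝ (Fin N) → ℝ} {p q p' q' : ℝ} (hp : 1 ≤ p) (hq : 1 ≤ q)
    (hp' : 1 ≤ p') (hq' : 1 ≤ q') {Ψ Ψ' : ℝ → ℝ} (hK : CondK N Ψ) (hK' : CondK N Ψ')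
    (hlimsup : ∃ c : ℝ, 0 < c ∧ ∃ᶠ r : ℝ in atTop,
      c ≤ min (r ^ (2 * (N : ℝ) - ((N : ℝ) - 2 * m) * (p + q)) * Ψ r)
        (r ^ (2 * (N : ℝ) - ((N : ℝ) - 2 * m) * (p' + q')) * Ψ' r))
    (hu : ContDiff ℝ (2 * m) u) (hu0 : ∀ x, 0 ≤ u x)
    (hv : ContDiff ℝ (2 * m) v) (hv0 : ∀ x, 0 ≤ v x)
    (hint : IntegrableOn (fun y : EuclideanSpace ℝ (Fin N) => v y ^ p * Ψ (‖y‖ / 2)) {y | 1 < ‖y‖})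
    (hint' : IntegrableOn (fun y : EuclideanSpace ℝ (Fin N) => u y ^ p' * Ψ' (‖y‖ / 2))
      {y | 1 < ‖y‖})
    (hineq : ∀ x, (∫ y, v y ^ p * Ψ ‖y - x‖) * u x ^ q ≤ negLapPow m u x)
    (hineq' : ∀ x, (∫ y, u y ^ p' * Ψ' ‖y - x‖) * v x ^ q' ≤ negLapPow m v x) :
    (∀ x, u x = 0) ∨ ∀ x, v x = 0 := by
  by_contra! hne
  obtain ⟨⟨a, ha⟩, b, hb⟩ := hne
  have hlimu := tendsto_annulus_average hu.continuous hu0 hp' hK' hint'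
  have hlimv := tendsto_annulus_average hv.continuous hv0 hp hK hint
  obtain ⟨δ, hδ, hδu⟩ := exists_pos_le_annulus_average hm hN hp hq hK hu hu0 hv.continuous hv0
    hint hineq hlimu ha hb
  obtain ⟨δ', hδ', hδv⟩ := exists_pos_le_annulus_average hm hN hp' hq' hK' hv hv0 hu.continuous hu0
    hint' hineq' hlimv hb ha
  obtain ⟨c, hc, hfreq⟩ := hlimsup
  obtain ⟨C, hC, hle⟩ := exists_setIntegral_negLapPow_le hm hN
  obtain ⟨c₁, hc₁, hlow⟩ := exists_le_setIntegral_annulus_negLapPow N m p q hp hq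
  obtain ⟨c₂, hc₂, hlow'⟩ := exists_le_setIntegral_annulus_negLapPow N m p' q' hp' hq'
  have hwu0 := negLapPow_nonneg_of_le hK hu0 hv0 hineq
  have hwv0 := negLapPow_nonneg_of_le hK' hv0 hu0 hineq'
  have hfreq' : ∃ᶠ R : ℝ in atTop,
      c ≤ (4 * R) ^ (2 * (N : ℝ) - ((N : ℝ) - 2 * m) * (p + q)) * Ψ (4 * R) ∧
      c ≤ (4 * R) ^ (2 * (N : ℝ) - ((N : ℝ) - 2 * m) * (p' + q')) * Ψ' (4 * R) := by
    have htend : Tendsto (fun r : ℝ => r / 4) atTop atTop :=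
      tendsto_id.atTop_div_const (by norm_num)
    refine htend.frequently (hfreq.mono fun r hr => ?_)
    rw [mul_div_cancel₀ r (by norm_num : (4 : ℝ) ≠ 0)]
    exact le_min_iff.1 hr
  have hgood := hfreq'.and_eventually (hδu.and (hδv.and (eventually_gt_atTop 0)))
  have hbdd : ∃ᶠ R : ℝ in atTop,
      ∫ x in closedBall (0 : EuclideanSpace ℝ (Fin N)) (2 * R), negLapPow m v x
        ≤ C * (1 + C / (c₁ * c * δ ^ (q - 1))) := by
    refine hgood.mono fun R hR => ?_
    obtain ⟨⟨hR1, -⟩, hRu, hRv, hR0⟩ := hR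
    refine (hle v hv hv0 hwv0 hlimv R hR0).trans (mul_le_mul_of_nonneg_left ?_ hC.le)
    have h1 := hlow Ψ u v hK hu hu0 hv.continuous hv0 hint hineq R hR0
    have h2 := hle u hu hu0 hwu0 hlimu R hR0
    have h3 : ∫ x in annulus N R, negLapPow m u x
        ≤ ∫ x in closedBall (0 : EuclideanSpace ℝ (Fin N)) (2 * R), negLapPow m u x :=
      setIntegral_mono_set ((continuous_negLapPow m hu).integrableOn_of_subset_closedBall subset_rfl)
        (ae_of_all _ hwu0) (annulus_subset_closedBall R).eventuallyLE
    exact le_one_add_div_of_mul_rpow_mul_rpow_le hp hq hc₁ hc hδ hR1 hRu (hδ'.le.trans hRv)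
      (h1.trans (h3.trans h2))
  have hzero := tendsto_setIntegral_annulus_of_frequently_le (continuous_negLapPow m hv) hwv0 hbdd
  have hsmall := hzero.eventually_lt_const (show 0 < c₂ * c * δ ^ p' * δ' ^ q' by positivity)
  obtain ⟨R, ⟨⟨-, hR1⟩, hRu, hRv, hR0⟩, hRlt⟩ := (hgood.and_eventually hsmall).exists
  have h1 := (hlow' Ψ' v u hK' hv hv0 hu.continuous hu0 hint' hineq' R hR0).trans_lt hRlt
  have hX := hc.le.trans hR1
  have hs := hδ.le.trans hRu
  refine absurd h1 (not_lt.2 ?_)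
  generalize (4 * R) ^ (2 * (N : ℝ) - ((N : ℝ) - 2 * m) * (p' + q')) * Ψ' (4 * R) = X at hR1 hX ⊢
  generalize (∫ x in annulus N R, u x) / R ^ (2 * m) = s at hRu hs ⊢
  gcongr

end Pair

theorem stmt_11 (N m : ℕ) (hm : 1 ≤ m) (hN : 2 * m < N)
    (n : ℕ) (hn : 2 ≤ n)
    (e : Fin n → Fin n → ℝ)
    (he : ∀ i j, e i j = if i = j then 0 else 1)
    (p q : Fin n → Fin n → ℝ)
    (hp : ∀ i j, i ≠ j → 1 ≤ p i j) (hq : ∀ i j, i ≠ j → 1 ≤ q i j)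
    (Ψ : Fin n → Fin n → ℝ → ℝ) (hK : ∀ i j, CondK N (Ψ i j))
    (hlimsup : ∀ k l : Fin n, k ≠ l → ∃ c : ℝ, 0 < c ∧ ∃ᶠ r : ℝ in atTop,
      c ≤ min (r ^ (2 * (N : ℝ) - ((N : ℝ) - 2 * m) * (p k l + q k l)) * Ψ k l r)
              (r ^ (2 * (N : ℝ) - ((N : ℝ) - 2 * m) * (p l k + q l k)) * Ψ l k r))
    (u : Fin n → EuclideanSpace ℝ (Fin N) → ℝ)
    (hreg : ∀ j, ContDiff ℝ (2 * m) (u j))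
    (hpos : ∀ j x, 0 ≤ u j x)
    (hint : ∀ i j, IntegrableOn
      (fun y : EuclideanSpace ℝ (Fin N) => u j y ^ p i j * Ψ i j (‖y‖ / 2))
      {y : EuclideanSpace ℝ (Fin N) | 1 < ‖y‖})
    (hineq : ∀ i, ∀ x : EuclideanSpace ℝ (Fin N),
      (∑ j, e i j * ((∫ y : EuclideanSpace ℝ (Fin N), u j y ^ p i j * Ψ i j ‖y - x‖)
        * u i x ^ q i j)) ≤ negLapPow m (u i) x) :
    ∃ j : Fin n, ∀ i : Fin n, i ≠ j → ∀ x, u i x = 0 := by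
  have : NeZero N := ⟨by omega⟩
  have hpair : ∀ k l, k ≠ l → ∀ x, (∫ y, u l y ^ p k l * Ψ k l ‖y - x‖) * u k x ^ q k l
      ≤ negLapPow m (u k) x := by
    intro k l hkl x
    refine le_trans ?_ (hineq k x)
    have hterm : ∀ j ∈ Finset.univ, 0 ≤ e k j *
        ((∫ y, u j y ^ p k j * Ψ k j ‖y - x‖) * u k x ^ q k j) := by
      intro j _
      refine mul_nonneg (by rw [he]; split_ifs <;> norm_num) (mul_nonneg ?_
        (Real.rpow_nonneg (hpos k x) _))
      exact integral_nonneg_of_ae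
        ((hK k j).ae_nonneg_mul (fun y => Real.rpow_nonneg (hpos j y) _) x)
    have hsum := Finset.single_le_sum hterm (Finset.mem_univ l)
    rwa [he, if_neg hkl, one_mul] at hsum
  by_cases hzero : ∀ i x, u i x = 0
  · exact ⟨⟨0, by omega⟩, fun i _ => hzero i⟩
  push Not at hzero
  obtain ⟨k, a, ha⟩ := hzero
  refine ⟨k, fun l hlk => ?_⟩
  have hkl := hlk.symm
  exact (eq_zero_or_eq_zero_of_le_negLapPow hm hN (hp k l hkl) (hq k l hkl) (hp l k hlk)
    (hq l k hlk) (hK k l) (hK l k) (hlimsup k l hkl) (hreg k) (hpos k) (hreg l) (hpos l)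
    (hint k l) (hint l k) (hpair k l hkl) (hpair l k hlk)).resolve_left fun h => ha (h a)
end

section
/- Let N, m ≥ 1 and let u ∈ C^{2m}(ℝ^N) satisfy u ≥ 0 and (−Δ)^m u ≤ 0 pointwise in ℝ^N. If ∫_{B_R} u dx = o(R^N) as R → ∞, then u ≡ 0. -/
open MeasureTheory Filter Metric

open scoped ContDiff Topology

/-- The truncated power `max (t - ‖x‖²) 0 ^ l`, supported in the ball of radius `√t`. -/
noncomputable def truncPow {N : ℕ} (l : ℕ) (t : ℝ) (x : EuclideanSpace ℝ (Fin N)) : ℝ :=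
  max (t - ‖x‖ ^ 2) 0 ^ l

/-- The integral of `v` against the truncated power of order `l`. -/
noncomputable def moment {N : ℕ} (v : EuclideanSpace ℝ (Fin N) → ℝ) (l : ℕ) (t : ℝ) : ℝ :=
  ∫ x, v x * truncPow l t x

theorem hasDerivAt_max_zero_pow (l : ℕ) (s : ℝ) :
    HasDerivAt (fun s : ℝ => max s 0 ^ (l + 2)) ((l + 2) * max s 0 ^ (l + 1)) s := by
  rcases lt_trichotomy s 0 with hs | rfl | hs
  · have h : (fun s : ℝ => max s 0 ^ (l + 2)) =ᶠ[𝓝 s] fun _ => 0 := by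
      filter_upwards [Iio_mem_nhds hs] with y hy
      simp [max_eq_right (Set.mem_Iio.1 hy).le]
    simpa [max_eq_right hs.le] using (hasDerivAt_const s (0 : ℝ)).congr_of_eventuallyEq h
  · rw [hasDerivAt_iff_isLittleO]
    have h1 : (fun s : ℝ => max s 0 ^ (l + 2)) =O[𝓝 0] fun s : ℝ => s ^ (l + 2) := by
      refine Asymptotics.IsBigO.of_bound 1 (Eventually.of_forall fun y => ?_)
      rw [one_mul, norm_pow, norm_pow]
      gcongr
      rcases le_total y 0 with h | h <;> simp [h]
    have h2 : (fun s : ℝ => s ^ (l + 2)) =o[𝓝 0] fun s : ℝ => s :=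
      Asymptotics.isLittleO_pow_id (by omega)
    simpa using h1.trans_isLittleO h2
  · have h : (fun s : ℝ => max s 0 ^ (l + 2)) =ᶠ[𝓝 s] fun s => s ^ (l + 2) := by
      filter_upwards [Ioi_mem_nhds hs] with y hy
      simp [max_eq_left (Set.mem_Ioi.1 hy).le]
    have := (hasDerivAt_pow (l + 2) s).congr_of_eventuallyEq h
    simpa [max_eq_left hs.le] using this

section
variable {N : ℕ}

theorem truncPow_nonneg (l : ℕ) (t : ℝ) (x : EuclideanSpace ℝ (Fin N)) : 0 ≤ truncPow l t x := by
  unfold truncPow; positivity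

theorem continuous_truncPow (l : ℕ) (t : ℝ) :
    Continuous (truncPow l t : EuclideanSpace ℝ (Fin N) → ℝ) := by
  unfold truncPow; fun_prop

theorem truncPow_eq_zero {l : ℕ} {t : ℝ} {x : EuclideanSpace ℝ (Fin N)} (h : t ≤ ‖x‖ ^ 2) :
    truncPow (l + 1) t x = 0 := by
  simp [truncPow, max_eq_right (sub_nonpos.2 h)]

theorem truncPow_eq_zero_of_notMem_ball {l : ℕ} {t : ℝ} {x : EuclideanSpace ℝ (Fin N)}
    (h : x ∉ ball (0 : EuclideanSpace ℝ (Fin N)) (√t)) : truncPow (l + 1) t x = 0 := by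
  refine truncPow_eq_zero ?_
  rw [mem_ball_zero_iff, not_lt] at h
  exact Real.sqrt_le_left (norm_nonneg x) |>.1 h

theorem hasCompactSupport_truncPow (l : ℕ) (t : ℝ) :
    HasCompactSupport (truncPow (l + 1) t : EuclideanSpace ℝ (Fin N) → ℝ) :=
  HasCompactSupport.intro (isCompact_closedBall 0 (√t)) fun _ hx =>
    truncPow_eq_zero_of_notMem_ball fun h => hx (ball_subset_closedBall h)

theorem integrable_mul_truncPow {v : EuclideanSpace ℝ (Fin N) → ℝ} (hv : Continuous v)
    (l : ℕ) (t : ℝ) : Integrable fun x => v x * truncPow (l + 1) t x :=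
  (hv.mul (continuous_truncPow _ t)).integrable_of_hasCompactSupport
    (hasCompactSupport_truncPow l t).mul_left

theorem norm_sq_mul_truncPow (l : ℕ) (t : ℝ) (x : EuclideanSpace ℝ (Fin N)) :
    ‖x‖ ^ 2 * truncPow (l + 1) t x = t * truncPow (l + 1) t x - truncPow (l + 2) t x := by
  rcases le_total (t - ‖x‖ ^ 2) 0 with h | h
  · simp [truncPow, h]
  · simp only [truncPow, max_eq_left h]
    ring

theorem hasFDerivAt_truncPow (l : ℕ) (t : ℝ) (x : EuclideanSpace ℝ (Fin N)) :
    HasFDerivAt (truncPow (l + 2) t)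
      ((-2 * (l + 2) * truncPow (l + 1) t x) • innerSL ℝ x) x := by
  have h := (hasDerivAt_max_zero_pow l (t - ‖x‖ ^ 2)).comp_hasFDerivAt x
    ((hasStrictFDerivAt_norm_sq x).hasFDerivAt.const_sub t)
  refine h.congr_fderiv ?_
  ext y
  simp [truncPow]
  ring

theorem lap_eq_sum (v : EuclideanSpace ℝ (Fin N) → ℝ) (x : EuclideanSpace ℝ (Fin N)) :
    lap v x = ∑ i, fderiv ℝ (fderiv ℝ v) x (EuclideanSpace.single i 1)
      (EuclideanSpace.single i 1) := by
  simp [lap, iteratedFDeriv_two_apply]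

theorem ContDiff.lap {n : WithTop ℕ∞} {v : EuclideanSpace ℝ (Fin N) → ℝ}
    (hv : ContDiff ℝ (n + 2) v) : ContDiff ℝ n (lap v) := by
  have h1 : ContDiff ℝ (n + 1) (fderiv ℝ v) :=
    hv.fderiv_right (by rw [add_assoc, one_add_one_eq_two])
  have h2 : ContDiff ℝ n (fderiv ℝ (fderiv ℝ v)) := h1.fderiv_right le_rfl
  have : _root_.lap v = _ := funext (lap_eq_sum v)
  rw [this]
  fun_prop

theorem contDiff_truncPow (l : ℕ) (t : ℝ) :
    ContDiff ℝ 1 (truncPow (l + 2) t : EuclideanSpace ℝ (Fin N) → ℝ) := by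
  refine contDiff_one_iff_hasFDerivAt.2 ⟨_, ?_, hasFDerivAt_truncPow l t⟩
  have := continuous_truncPow (N := N) (l + 1) t
  have h2 : Continuous fun x : EuclideanSpace ℝ (Fin N) => innerSL ℝ x := (innerSL ℝ).continuous
  fun_prop

theorem integral_fderiv_mul_of_hasCompactSupport {f g : EuclideanSpace ℝ (Fin N) → ℝ}
    (hf : ContDiff ℝ 1 f) (hg : ContDiff ℝ 1 g) (hc : HasCompactSupport g)
    (e : EuclideanSpace ℝ (Fin N)) :
    ∫ x, fderiv ℝ f x e * g x = -∫ x, f x * fderiv ℝ g x e := by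
  have hf' := hf.continuous_fderiv one_ne_zero
  have hg' := hg.continuous_fderiv one_ne_zero
  have hfc := hf.continuous
  have hgc := hg.continuous
  rw [integral_mul_fderiv_eq_neg_fderiv_mul_of_integrable, neg_neg]
  · exact (show Continuous fun x => fderiv ℝ f x e * g x by fun_prop)
      |>.integrable_of_hasCompactSupport hc.mul_left
  · exact (show Continuous fun x => f x * fderiv ℝ g x e by fun_prop)
      |>.integrable_of_hasCompactSupport (hc.fderiv_apply ℝ e).mul_left
  · exact (hfc.mul hgc).integrable_of_hasCompactSupport hc.mul_left
  · exact fun x _ => hf.differentiable one_ne_zero x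
  · exact fun x _ => hg.differentiable one_ne_zero x

theorem fderiv_truncPow_single (l : ℕ) (t : ℝ) (i : Fin N) (x : EuclideanSpace ℝ (Fin N)) :
    fderiv ℝ (truncPow (l + 2) t) x (EuclideanSpace.single i 1) =
      -2 * (l + 2) * (x i * truncPow (l + 1) t x) := by
  rw [(hasFDerivAt_truncPow l t x).fderiv]
  simp [EuclideanSpace.inner_single_right]
  ring

theorem fderiv_coord_mul_truncPow_single (l : ℕ) (t : ℝ) (i : Fin N)
    (x : EuclideanSpace ℝ (Fin N)) :
    fderiv ℝ (fun x : EuclideanSpace ℝ (Fin N) => x i * truncPow (l + 2) t x) x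
        (EuclideanSpace.single i 1) =
      truncPow (l + 2) t x - 2 * (l + 2) * (x i ^ 2 * truncPow (l + 1) t x) := by
  have h : HasFDerivAt (fun x : EuclideanSpace ℝ (Fin N) => x i)
      (EuclideanSpace.proj i : EuclideanSpace ℝ (Fin N) →L[ℝ] ℝ) x :=
    (EuclideanSpace.proj i : EuclideanSpace ℝ (Fin N) →L[ℝ] ℝ).hasFDerivAt
  rw [(h.fun_mul (hasFDerivAt_truncPow l t x)).fderiv]
  simp [EuclideanSpace.inner_single_right]
  ring

theorem integral_fderiv_fderiv_mul_truncPow {v : EuclideanSpace ℝ (Fin N) → ℝ}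
    (hv : ContDiff ℝ 2 v) (l : ℕ) (t : ℝ) (i : Fin N) :
    ∫ x, fderiv ℝ (fderiv ℝ v) x (EuclideanSpace.single i 1) (EuclideanSpace.single i 1) *
        truncPow (l + 3) t x =
      ∫ x, v x * (4 * (l + 3) * (l + 2) * (x i ^ 2 * truncPow (l + 1) t x) -
        2 * (l + 3) * truncPow (l + 2) t x) := by
  have h1 : ContDiff ℝ 1 fun x => fderiv ℝ v x (EuclideanSpace.single i 1) :=
    (hv.fderiv_right (by rw [one_add_one_eq_two])).clm_apply contDiff_const
  have h2 : ContDiff ℝ 1 fun x : EuclideanSpace ℝ (Fin N) => x i * truncPow (l + 2) t x :=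
    ContDiff.mul (by fun_prop) (contDiff_truncPow l t)
  have h3 : ∀ x, fderiv ℝ (fun x => fderiv ℝ v x (EuclideanSpace.single i 1)) x
      (EuclideanSpace.single i 1) =
      fderiv ℝ (fderiv ℝ v) x (EuclideanSpace.single i 1) (EuclideanSpace.single i 1) := by
    intro x
    rw [fderiv_clm_apply]
    · simp
    · exact (hv.fderiv_right (m := 1) (by rw [one_add_one_eq_two])).differentiable one_ne_zero x
    · fun_prop
  have key1 := integral_fderiv_mul_of_hasCompactSupport h1 (contDiff_truncPow (l + 1) t)
    (hasCompactSupport_truncPow (l + 2) t) (EuclideanSpace.single i 1)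
  have key2 := integral_fderiv_mul_of_hasCompactSupport (hv.of_le one_le_two) h2
    (hasCompactSupport_truncPow (l + 1) t).mul_left (EuclideanSpace.single i 1)
  simp only [h3, fderiv_truncPow_single] at key1
  simp only [fderiv_coord_mul_truncPow_single] at key2
  rw [key1, ← integral_neg]
  calc _ = ∫ x, 2 * (l + 3 : ℝ) * (fderiv ℝ v x (EuclideanSpace.single i 1) *
          (x i * truncPow (l + 2) t x)) := by
        congr 1 with x
        push_cast
        ring
    _ = _ := by
        rw [integral_const_mul, key2, ← integral_neg, ← integral_const_mul]
        congr 1 with x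
        ring


theorem moment_lap {v : EuclideanSpace ℝ (Fin N) → ℝ} (hv : ContDiff ℝ 2 v) (l : ℕ) (t : ℝ) :
    moment (lap v) (l + 3) t = 4 * (l + 3) *
      ((l + 2) * (t * moment v (l + 1) t) - (l + 2 + N / 2) * moment v (l + 2) t) := by
  have hc := hv.continuous
  have h1 : ContDiff ℝ 1 (fderiv ℝ v) := hv.fderiv_right (by rw [one_add_one_eq_two])
  have h2 : Continuous (fderiv ℝ (fderiv ℝ v)) := h1.continuous_fderiv one_ne_zero
  have hi1 := integrable_mul_truncPow hc l t
  have hi2 := integrable_mul_truncPow hc (l + 1) t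
  simp only [moment, lap_eq_sum, Finset.sum_mul]
  rw [integral_finsetSum _ fun i _ => integrable_mul_truncPow (by fun_prop) (l + 2) t]
  simp only [integral_fderiv_fderiv_mul_truncPow hv]
  rw [← integral_finsetSum]
  · rw [← integral_const_mul, ← integral_const_mul, ← integral_const_mul, ← integral_sub,
      ← integral_const_mul]
    · refine integral_congr_ae (Eventually.of_forall fun x => ?_)
      have hx : ∑ i, x i ^ 2 = ‖x‖ ^ 2 := by simp [EuclideanSpace.norm_sq_eq]
      have hs := norm_sq_mul_truncPow l t x
      simp only [← Finset.mul_sum, Finset.sum_sub_distrib, ← Finset.sum_mul, hx, hs]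
      simp
      ring
    · exact (hi1.const_mul t).const_mul _
    · exact hi2.const_mul _
  · intro i _
    have hi3 := integrable_mul_truncPow
      (show Continuous fun x : EuclideanSpace ℝ (Fin N) => v x * x i ^ 2 by fun_prop) l t
    convert (hi3.const_mul (4 * (l + 3) * (l + 2) : ℝ)).sub (hi2.const_mul (2 * (l + 3) : ℝ))
      using 2 with x
    simp
    ring

theorem hasDerivAt_moment {v : EuclideanSpace ℝ (Fin N) → ℝ} (hv : Continuous v) (l : ℕ) (t : ℝ) :
    HasDerivAt (moment v (l + 2)) ((l + 2) * moment v (l + 1) t) t := by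
  have h := hasDerivAt_integral_of_dominated_loc_of_deriv_le (μ := volume)
    (F := fun t x => v x * truncPow (l + 2) t x)
    (F' := fun t x => v x * ((l + 2) * truncPow (l + 1) t x))
    (bound := fun x => ‖v x * ((l + 2) * truncPow (l + 1) (t + 1) x)‖)
    (ball_mem_nhds t one_pos)
    (Eventually.of_forall fun s => (integrable_mul_truncPow hv _ s).aestronglyMeasurable)
    (integrable_mul_truncPow hv _ t)
    (hv.mul (continuous_const.mul (continuous_truncPow _ t))).aestronglyMeasurable
    (Eventually.of_forall fun x s hs => ?_) ?_
    (Eventually.of_forall fun x s _ => ?_)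
  · refine h.2.congr_deriv ?_
    simp only [moment]
    rw [← integral_const_mul]
    congr 1 with x
    ring
  · simp only [norm_mul, Real.norm_of_nonneg (truncPow_nonneg _ _ _)]
    gcongr
    have := (abs_lt.1 (Real.dist_eq s t ▸ mem_ball.1 hs)).2
    unfold truncPow
    gcongr
    linarith
  · refine Integrable.norm ?_
    convert (integrable_mul_truncPow hv l (t + 1)).const_mul (l + 2 : ℝ) using 2 with x
    ring
  · have := (hasDerivAt_max_zero_pow l (s - ‖x‖ ^ 2)).comp s ((hasDerivAt_id s).sub_const _)
    simpa [truncPow] using this.const_mul (v x)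

theorem moment_nonpos_of_moment_lap_nonneg {v : EuclideanSpace ℝ (Fin N) → ℝ}
    (hv : ContDiff ℝ 2 v) (l : ℕ)
    (ho : moment v (l + 2) =o[atTop] fun t : ℝ => t ^ (l + 2 + N / 2 : ℝ))
    (hl : ∀ t, 0 < t → 0 ≤ moment (lap v) (l + 3) t) {t : ℝ} (ht : 0 < t) :
    moment v (l + 2) t ≤ 0 := by
  set β : ℝ := l + 2 + N / 2 with hβ
  have hd : ∀ s : ℝ, 0 < s → HasDerivAt (fun s => moment v (l + 2) s / s ^ β) _ s :=
    fun s hs => (hasDerivAt_moment hv.continuous l s).fun_div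
      (Real.hasDerivAt_rpow_const (p := β) (.inl hs.ne')) (Real.rpow_pos_of_pos hs β).ne'
  have hmono : MonotoneOn (fun s => moment v (l + 2) s / s ^ β) (Set.Ioi 0) := by
    refine monotoneOn_of_deriv_nonneg (convex_Ioi 0)
      (fun s hs => (hd s hs).continuousAt.continuousWithinAt)
      (fun s hs => (hd s (interior_subset hs)).differentiableAt.differentiableWithinAt)
      (fun s hs => ?_)
    have hs : 0 < s := interior_subset hs
    rw [(hd s hs).deriv]
    refine div_nonneg ?_ (sq_nonneg _)
    have h := hl s hs
    rw [moment_lap hv] at h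
    have h := nonneg_of_mul_nonneg_right h (by positivity)
    have hp : s ^ β = s ^ (β - 1) * s := by
      rw [Real.rpow_sub_one hs.ne', div_mul_cancel₀ _ hs.ne']
    have h := mul_nonneg (Real.rpow_nonneg hs.le (β - 1)) h
    rw [hp]
    convert h using 1
    rw [hβ]
    ring
  have h := ge_of_tendsto ho.tendsto_div_nhds_zero
    ((eventually_ge_atTop t).mono fun s hs => hmono ht (ht.trans_le hs) hs)
  have hp := Real.rpow_pos_of_pos ht β
  simpa using (div_le_iff₀ hp).1 h

theorem isLittleO_moment_lap {v : EuclideanSpace ℝ (Fin N) → ℝ} (hv : ContDiff ℝ 2 v) (l : ℕ)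
    (h1 : moment v (l + 1) =o[atTop] fun t : ℝ => t ^ (l + 1 + N / 2 : ℝ))
    (h2 : moment v (l + 2) =o[atTop] fun t : ℝ => t ^ (l + 2 + N / 2 : ℝ)) :
    moment (lap v) (l + 3) =o[atTop] fun t : ℝ => t ^ (l + 3 + N / 2 : ℝ) := by
  have hle : (fun t : ℝ => t ^ (l + 2 + N / 2 : ℝ)) =O[atTop]
      fun t : ℝ => t ^ (l + 3 + N / 2 : ℝ) := by
    refine Asymptotics.IsBigO.of_bound 1 ((eventually_ge_atTop 1).mono fun t ht => ?_)
    have h0 : (0 : ℝ) ≤ t := zero_le_one.trans ht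
    rw [one_mul, Real.norm_of_nonneg (Real.rpow_nonneg h0 _),
      Real.norm_of_nonneg (Real.rpow_nonneg h0 _)]
    exact Real.rpow_le_rpow_of_exponent_le ht (by linarith)
  have h3 : (fun t : ℝ => t * moment v (l + 1) t) =o[atTop]
      fun t : ℝ => t ^ (l + 2 + N / 2 : ℝ) := by
    refine ((Asymptotics.isBigO_refl (fun t : ℝ => t) atTop).mul_isLittleO h1).congr'
      .rfl ((eventually_gt_atTop 0).mono fun t ht => ?_)
    beta_reduce
    rw [← Real.rpow_one_add' ht.le (by positivity)]
    congr 1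
    ring
  have h4 := ((h3.const_mul_left (l + 2 : ℝ)).sub
    (h2.const_mul_left (l + 2 + N / 2 : ℝ))).const_mul_left (4 * (l + 3) : ℝ)
  exact (h4.trans_isBigO hle).congr_left fun t => (moment_lap hv l t).symm

theorem moment_neg (v : EuclideanSpace ℝ (Fin N) → ℝ) (l : ℕ) :
    moment (fun x => -v x) l = fun t => -moment v l t := by
  ext t
  simp [moment, integral_neg]

theorem eventually_moment_nonpos (m : ℕ) {v : EuclideanSpace ℝ (Fin N) → ℝ}
    (hv : ContDiff ℝ (2 * m) v)
    (ho : ∀ᶠ l : ℕ in atTop, moment v l =o[atTop] fun t : ℝ => t ^ (l + N / 2 : ℝ))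
    (hm : ∀ x, negLapPow m v x ≤ 0) :
    ∀ᶠ l : ℕ in atTop, ∀ t, 0 < t → moment v l t ≤ 0 := by
  induction m generalizing v with
  | zero =>
    exact Eventually.of_forall fun l t _ => integral_nonpos fun x =>
      mul_nonpos_of_nonpos_of_nonneg (hm x) (truncPow_nonneg l t x)
  | succ m ih =>
    have hv' : ContDiff ℝ (2 * m + 2) v := by
      convert hv using 1
      push_cast
      ring
    have hv2 : ContDiff ℝ 2 v := hv'.of_le (by simp)
    obtain ⟨a, ha⟩ := eventually_atTop.1 ho
    have ho' : ∀ᶠ l : ℕ in atTop, moment (fun x => -lap v x) l =o[atTop]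
        fun t : ℝ => t ^ (l + N / 2 : ℝ) := by
      filter_upwards [eventually_ge_atTop (a + 3)] with l hl
      obtain ⟨k, rfl⟩ : ∃ k, l = k + 3 := ⟨l - 3, by omega⟩
      have h1 := ha (k + 1) (by omega)
      have h2 := ha (k + 2) (by omega)
      push_cast at h1 h2 ⊢
      rw [moment_neg]
      exact (isLittleO_moment_lap hv2 k h1 h2).neg_left
    obtain ⟨b, hb⟩ := eventually_atTop.1 (ih hv'.lap.neg ho' hm)
    filter_upwards [eventually_ge_atTop (a + b + 2)] with l hl t ht
    obtain ⟨k, rfl⟩ : ∃ k, l = k + 2 := ⟨l - 2, by omega⟩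
    have h2 := ha (k + 2) (by omega)
    push_cast at h2
    refine moment_nonpos_of_moment_lap_nonneg hv2 k h2 (fun s hs => ?_) ht
    have := hb (k + 3) (by omega) s hs
    rw [moment_neg] at this
    linarith

theorem isLittleO_moment {u : EuclideanSpace ℝ (Fin N) → ℝ} (hu : Continuous u)
    (hpos : ∀ x, 0 ≤ u x)
    (ho : (fun R : ℝ => ∫ x in ball (0 : EuclideanSpace ℝ (Fin N)) R, u x)
      =o[atTop] fun R : ℝ => R ^ N) (l : ℕ) :
    moment u (l + 1) =o[atTop] fun t : ℝ => t ^ ((l + 1 : ℕ) + N / 2 : ℝ) := by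
  have h1 := (Asymptotics.isBigO_refl (fun t : ℝ => t ^ (l + 1)) atTop).mul_isLittleO
    (ho.comp_tendsto Real.tendsto_sqrt_atTop)
  have h2 : moment u (l + 1) =O[atTop] fun t : ℝ =>
      t ^ (l + 1) * ∫ x in ball (0 : EuclideanSpace ℝ (Fin N)) (√t), u x := by
    refine Asymptotics.IsBigO.of_bound 1 ((eventually_ge_atTop 0).mono fun t ht => ?_)
    have hint : IntegrableOn u (ball 0 (√t)) :=
      (hu.continuousOn.integrableOn_compact (isCompact_closedBall 0 (√t))).mono_set ball_subset_closedBall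
    have h0 : 0 ≤ moment u (l + 1) t :=
      integral_nonneg fun x => mul_nonneg (hpos x) (truncPow_nonneg _ t x)
    rw [one_mul, Real.norm_of_nonneg h0]
    refine le_trans ?_ (le_abs_self _)
    rw [moment, ← setIntegral_eq_integral_of_forall_compl_eq_zero (s := ball 0 (√t))
      fun x hx => by rw [truncPow_eq_zero_of_notMem_ball hx, mul_zero], ← integral_const_mul]
    refine setIntegral_mono (integrable_mul_truncPow hu l t).integrableOn (hint.const_mul _)
      fun x => ?_
    rw [mul_comm]
    refine mul_le_mul_of_nonneg_right ?_ (hpos x)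
    unfold truncPow
    gcongr
    exact max_le (by linarith [sq_nonneg ‖x‖]) ht
  refine (h2.trans_isLittleO h1).congr' .rfl ((eventually_gt_atTop 0).mono fun t ht => ?_)
  simp only [Function.comp]
  rw [Real.rpow_add ht, Real.rpow_natCast, Real.sqrt_eq_rpow, ← Real.rpow_natCast (t ^ _),
    ← Real.rpow_mul ht.le]
  congr 2
  ring

end

theorem stmt_13 (N m : ℕ) (hN : 1 ≤ N) (hm : 1 ≤ m)
    (u : EuclideanSpace ℝ (Fin N) → ℝ)
    (hreg : ContDiff ℝ (2 * m) u)
    (hpos : ∀ x, 0 ≤ u x)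
    (hsup : ∀ x, negLapPow m u x ≤ 0)
    (hlittleo : (fun R : ℝ => ∫ x in Metric.ball (0 : EuclideanSpace ℝ (Fin N)) R, u x)
      =o[atTop] fun R : ℝ => R ^ N) :
    ∀ x, u x = 0 := by
  have hu := hreg.continuous
  have ho : ∀ᶠ l : ℕ in atTop, moment u l =o[atTop] fun t : ℝ => t ^ (l + N / 2 : ℝ) := by
    filter_upwards [eventually_ge_atTop 1] with l hl
    obtain ⟨k, rfl⟩ : ∃ k, l = k + 1 := ⟨l - 1, by omega⟩
    exact isLittleO_moment hu hpos hlittleo k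
  obtain ⟨l, hl, hl1⟩ := ((eventually_moment_nonpos m hreg ho hsup).and
    (eventually_ge_atTop 1)).exists
  obtain ⟨k, rfl⟩ : ∃ k, l = k + 1 := ⟨l - 1, by omega⟩
  intro x
  have hnn : 0 ≤ fun y => u y * truncPow (k + 1) (‖x‖ ^ 2 + 1) y :=
    fun y => mul_nonneg (hpos y) (truncPow_nonneg _ _ y)
  have h0 := (integral_eq_zero_iff_of_nonneg hnn (integrable_mul_truncPow hu k _)).1
    (le_antisymm (hl _ (by positivity)) (integral_nonneg hnn))
  have h1 : u x * truncPow (k + 1) (‖x‖ ^ 2 + 1) x = 0 := congrFun ((Continuous.ae_eq_iff_eq volume (hu.mul (continuous_truncPow _ _))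
    continuous_const).1 h0) x
  simpa [truncPow] using h1
end
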